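/- (Definability of forcing) Let M be a countable transitive set with (M,∈) ⊨ ZF and let ⟨P,≼,𝟙⟩ ∈ M be a forcing notion. There is a function mapping each L-formula φ to an L-formula forces(φ), whose arity is at most arity(φ) + 4, such that for every L-formula φ with arity(φ) ≤ n, all p ∈ P and all τ₁,…,τₙ ∈ M: (M,∈) ⊨ forces(φ)[p, P, ≼, 𝟙, τ₁,…,τₙ] if and only if for every M-generic filter G with p ∈ G, (M[G],∈) ⊨ φ[val(G,τ₁),…,val(G,τₙ)]. -/

import Mathlib

namespace CtmForcing

open FirstOrder FirstOrder.Language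

/-! ### The first-order language of set theory -/

/-- The relation symbols of the language of set theory: a single binary relation `∈`. -/
inductive memRel : ℕ → Type
  | mem : memRel 2

/-- The first-order language `L` of set theory, with a single binary relation symbol `∈`. -/
def SetLang : Language := ⟨fun _ => Empty, memRel⟩

/-- The membership relation symbol. -/
abbrev memSymb : SetLang.Relations 2 := .mem

/-- `L`-formulas (with no free "unbounded" variables) whose free variables are among
`v₀, …, v_{n-1}`. -/
abbrev BF (n : ℕ) := SetLang.BoundedFormula Empty n

/-- The atomic formula `vᵢ ∈ vⱼ`. -/
def memf {n : ℕ} (i j : Fin n) : BF n :=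
  memSymb.boundedFormula₂ (Term.var (Sum.inr i)) (Term.var (Sum.inr j))

/-- The atomic formula `vᵢ = vⱼ`. -/
def eqf {n : ℕ} (i j : Fin n) : BF n :=
  Term.bdEqual (Term.var (Sum.inr i)) (Term.var (Sum.inr j))

/-- Rename the free variables of a formula along `f`. -/
def reindex {m k : ℕ} (f : Fin m → Fin k) (φ : BF m) : BF k :=
  (BoundedFormula.relabel (Sum.map id f) φ.toFormula : SetLang.BoundedFormula Empty (k + 0))

/-- Conjunction. -/
def andF {n : ℕ} (φ ψ : BF n) : BF n := (φ.imp ψ.not).not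

/-- Disjunction. -/
def orF {n : ℕ} (φ ψ : BF n) : BF n := (φ.not).imp ψ

/-- Biimplication. -/
def iffF {n : ℕ} (φ ψ : BF n) : BF n := andF (φ.imp ψ) (ψ.imp φ)

/-! ### Basic set-theoretic formulas -/

/-- `v₀ ⊆ v₁`. -/
def subF : BF 2 := ((memf 2 0).imp (memf 2 1)).all

/-- `v₀ = ∅`. -/
def emptyF : BF 1 := ((memf 1 0).not).all

/-- `v₂ = {v₀, v₁}`. -/
def pairSetF : BF 3 := (iffF (memf 3 2) (orF (eqf 3 0) (eqf 3 1))).all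

/-- `v₁ = {v₀}`. -/
def singF : BF 2 := reindex ![0, 0, 1] pairSetF

/-- `v₂ = ⟨v₀, v₁⟩` (Kuratowski ordered pair). -/
def opF : BF 3 :=
  (iffF (memf 3 2) (orF (reindex ![0, 3] singF) (reindex ![0, 1, 3] pairSetF))).all

/-- `v₁ = v₀ ∪ {v₀}`. -/
def succF : BF 2 := (iffF (memf 2 1) (orF (memf 2 0) (eqf 2 0))).all

/-- `v₀` is transitive. -/
def transF : BF 1 := ((memf 1 0).imp (reindex ![1, 0] subF)).all

/-- `v₀` is an ordinal (a transitive set of transitive sets). -/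
def ordF : BF 1 := andF transF (((memf 1 0).imp (reindex ![1] transF)).all)

/-- `⟨v₀, v₁⟩ ∈ v₂`. -/
def relMemF : BF 3 := (andF (reindex ![0, 1, 3] opF) (memf 3 2)).ex

/-- `v₂` is a function with domain `v₀` mapping onto `v₁` (a surjection from `v₀` onto `v₁`). -/
def isFuncF : BF 3 :=
  andF
    (andF
      -- v₂ ⊆ v₀ × v₁
      (((memf 3 2).imp
        (((andF (andF (memf 4 0) (memf 5 1)) (reindex ![4, 5, 3] opF)).ex).ex)).all)
      -- total on v₀
      (((memf 3 0).imp ((andF (memf 4 1) (reindex ![3, 4, 2] relMemF)).ex)).all))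
    (andF
      -- functional
      ((((andF (reindex ![3, 4, 2] relMemF) (reindex ![3, 5, 2] relMemF)).imp
          (eqf 4 5)).all).all.all)
      -- onto v₁
      (((memf 3 1).imp ((andF (memf 4 0) (reindex ![4, 3, 2] relMemF)).ex)).all))

/-- `v₂` is injective (as a set of ordered pairs). -/
def injF : BF 3 :=
  ((((andF (reindex ![3, 5, 2] relMemF) (reindex ![4, 5, 2] relMemF)).imp
      (eqf 3 4)).all).all).all

/-- `v₂` is a bijection from `v₀` onto `v₁`. -/
def bijF : BF 3 := andF isFuncF injF

/-! ### The axioms of set theory as `L`-sentences -/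

/-- Extensionality. -/
def extAx : SetLang.Sentence :=
  ((((andF subF (reindex ![1, 0] subF)).imp (eqf 0 1)).all).all : BF 0)

/-- Foundation. -/
def foundAx : SetLang.Sentence :=
  (((((memf 1 0).ex).imp
    ((andF (memf 1 0) (((memf 2 0).imp ((memf 2 1).not)).all)).ex)).all) : BF 0)

/-- Pairing. -/
def pairAx : SetLang.Sentence := (((pairSetF.ex).all).all : BF 0)

/-- Union. -/
def unionAx : SetLang.Sentence :=
  (((((iffF (memf 2 1) ((andF (memf 3 0) (memf 2 3)).ex)).all).ex).all : BF 0))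

/-- Powerset. -/
def powF : BF 2 := (iffF (memf 2 1) (reindex ![2, 0] subF)).all

/-- Powerset axiom. -/
def powAx : SetLang.Sentence := (((powF.ex).all) : BF 0)

/-- Infinity. -/
def infAx : SetLang.Sentence :=
  (((andF ((andF (memf 1 0) (reindex ![1] emptyF)).ex)
    (((memf 1 0).imp ((andF (memf 2 0) (reindex ![1, 2] succF)).ex)).all)).ex) : BF 0)

/-- The instance of the Separation scheme given by `φ`, whose free variables are among
`v₀, …, vₙ`: the parameters are `v₀, …, v_{n-1}` and the tested element is `vₙ`.  It is the
universal closure of `∀A ∃B ∀x (x ∈ B ↔ x ∈ A ∧ φ(params, x))`. -/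
def sepAx {n : ℕ} (φ : BF (n + 1)) : SetLang.Sentence :=
  -- context `n+3`: parameters `0,…,n-1`, `A = n`, `B = n+1`, `x = n+2`
  let A : Fin (n + 3) := ⟨n, by omega⟩
  let B : Fin (n + 3) := ⟨n + 1, by omega⟩
  let x : Fin (n + 3) := ⟨n + 2, by omega⟩
  let φ' : BF (n + 3) := reindex (fun i => if h : (i : ℕ) < n then ⟨i, by omega⟩ else x) φ
  ((((iffF (memf x B) (andF (memf x A) φ')).all).ex).all).alls

/-- The instance of the Replacement scheme given by `φ`, whose free variables are among
`v₀, …, v_{n+1}`: the parameters are `v₀, …, v_{n-1}`, the argument is `x = vₙ`, and the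
value is `y = v_{n+1}`.  It is the universal closure of
`∀A [(∀x∈A ∀y ∀y' (φ(x,y) ∧ φ(x,y') → y = y')) → ∃B ∀y (y ∈ B ↔ ∃x∈A φ(x,y))]`. -/
def replAx {n : ℕ} (φ : BF (n + 2)) : SetLang.Sentence :=
  -- functionality context `n+4`: parameters, `A = n`, `x = n+1`, `y = n+2`, `y' = n+3`
  let A : Fin (n + 4) := ⟨n, by omega⟩
  let x : Fin (n + 4) := ⟨n + 1, by omega⟩
  let y : Fin (n + 4) := ⟨n + 2, by omega⟩
  let y' : Fin (n + 4) := ⟨n + 3, by omega⟩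
  let φ₁ : BF (n + 4) :=
    reindex (fun i => if h : (i : ℕ) < n then ⟨i, by omega⟩ else if (i : ℕ) = n then x else y) φ
  let φ₂ : BF (n + 4) :=
    reindex (fun i => if h : (i : ℕ) < n then ⟨i, by omega⟩ else if (i : ℕ) = n then x else y') φ
  let funcl : BF (n + 1) :=
    ((((andF (memf x A) (andF φ₁ φ₂)).imp (eqf y y')).all).all).all
  -- image context `n+4`: parameters, `A = n`, `B = n+1`, `y = n+2`, `x = n+3`
  let xi : Fin (n + 4) := ⟨n + 3, by omega⟩
  let yi : Fin (n + 4) := ⟨n + 2, by omega⟩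
  let B3 : Fin (n + 3) := ⟨n + 1, by omega⟩
  let y3 : Fin (n + 3) := ⟨n + 2, by omega⟩
  let φ₃ : BF (n + 4) :=
    reindex (fun i => if h : (i : ℕ) < n then ⟨i, by omega⟩ else if (i : ℕ) = n then xi else yi) φ
  let image : BF (n + 1) :=
    (((iffF (memf y3 B3) ((andF (memf xi A) φ₃).ex)).all).ex)
  ((funcl.imp image).all).alls

/-- The Axiom of Choice: every set is the surjective image of an ordinal. -/
def acAx : SetLang.Sentence :=
  ((((andF (reindex ![1] ordF) (reindex ![1, 0, 2] isFuncF)).ex).ex).all : BF 0)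

/-- `v₀ = ω`: `v₀` is an ordinal containing `∅`, closed under successors, each of whose
elements is `∅` or a successor. -/
def omegaF : BF 1 :=
  andF (andF ordF ((andF (memf 1 0) (reindex ![1] emptyF)).ex))
    (andF (((memf 1 0).imp ((andF (memf 2 0) (reindex ![1, 2] succF)).ex)).all)
      (((memf 1 0).imp
        (orF (reindex ![1] emptyF) ((andF (memf 2 1) (reindex ![2, 1] succF)).ex))).all))

/-- Given `v₀ = ω`, `v₁ = ℵ₁`: `v₁` is an ordinal, there is no surjection from `ω` onto `v₁`,
and every element of `v₁` is empty or a surjective image of `ω`. -/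
def alephOneF : BF 2 :=
  andF (andF (reindex ![1] ordF) (((reindex ![0, 1, 2] isFuncF).ex).not))
    (((memf 2 1).imp (orF (reindex ![2] emptyF) ((reindex ![0, 2, 3] isFuncF).ex))).all)

/-- The Continuum Hypothesis `ℵ₁ = 2^ℵ₀`: there is a bijection between `𝒫(ω)` and `ℵ₁`. -/
def chSent : SetLang.Sentence :=
  (((((andF (andF (reindex ![0] omegaF) (reindex ![0, 1] powF))
      (andF (reindex ![0, 2] alephOneF) (reindex ![1, 2, 3] bijF))).ex).ex).ex).ex : BF 0)

/-! ### The theories `Z`, `ZF`, `ZC`, `ZFC` -/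

/-- The finitely many non-scheme axioms of `ZF`. -/
def zfFin : SetLang.Theory := {extAx, foundAx, pairAx, unionAx, powAx, infAx}

/-- All instances of the Separation scheme. -/
def sepScheme : SetLang.Theory := Set.range fun p : Σ n, BF (n + 1) => sepAx p.2

/-- All instances of the Replacement scheme. -/
def replScheme : SetLang.Theory := Set.range fun p : Σ n, BF (n + 2) => replAx p.2

/-- Zermelo set theory. -/
def Z : SetLang.Theory := zfFin ∪ sepScheme

/-- Zermelo–Fraenkel set theory. -/
def ZF : SetLang.Theory := Z ∪ replScheme

/-- Zermelo set theory with Choice. -/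
def ZC : SetLang.Theory := Z ∪ {acAx}

/-- Zermelo–Fraenkel set theory with Choice. -/
def ZFC : SetLang.Theory := ZF ∪ {acAx}

/-! ### Satisfaction in a set with the true membership relation -/

/-- The `L`-structure on (the elements of) a `ZFSet` `M`, with `∈` interpreted as true
membership. -/
def zfStruct (M : ZFSet) : SetLang.Structure {x : ZFSet // x ∈ M} where
  funMap := fun f _ => f.elim
  RelMap | .mem => fun v => ((v 0 : {x : ZFSet // x ∈ M}) : ZFSet) ∈ ((v 1 : {x : ZFSet // x ∈ M}) : ZFSet)

/-- `(M, ∈) ⊨ T`: the structure on `M` with true membership satisfies every sentence of `T`. -/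
def ZModels (M : ZFSet) (T : SetLang.Theory) : Prop :=
  ∀ φ ∈ T, letI := zfStruct M; Sentence.Realize (M := {x : ZFSet // x ∈ M}) φ

/-- `(M, ∈) ⊨ φ[v₀, …, v_{k-1}]`: satisfaction of the formula `φ` in `M`, with the
(membership-checked) valuation `v` of its free variables. -/
def ZRealize (M : ZFSet) {k : ℕ} (φ : BF k) (v : Fin k → ZFSet) : Prop :=
  ∀ h : ∀ i, v i ∈ M,
    letI := zfStruct M
    BoundedFormula.Realize (M := {x : ZFSet // x ∈ M}) φ (fun e => e.elim) (fun i => ⟨v i, h i⟩)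

/-- `x` is a (von Neumann) ordinal: a transitive set of transitive sets. -/
def IsOrd (x : ZFSet) : Prop := x.IsTransitive ∧ ∀ y ∈ x, ZFSet.IsTransitive y


/-! ### Forcing: names, values, generic extensions -/

/-- The value `val(G, τ)` of a name `τ` under `G`, defined by `∈`-recursion:
`val(G, τ) = { val(G, σ) : ∃ p ∈ G, ⟨σ, p⟩ ∈ τ }`. -/
noncomputable def zval (G : ZFSet) : ZFSet → ZFSet :=
  (InvImage.wf ZFSet.rank Ordinal.lt_wf).fix fun τ ih =>
    letI : ∀ (n : ℕ) (f : (Fin n → ZFSet) → ZFSet), ZFSet.Definable n f := fun _ _ => Classical.allZFSetDefinable _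
    ZFSet.image (fun σ => if h : ZFSet.rank σ < ZFSet.rank τ then ih σ h else ∅)
      (ZFSet.sep (fun σ => ∃ p ∈ G, ZFSet.pair σ p ∈ τ) (ZFSet.sUnion (ZFSet.sUnion τ)))

/-- The generic extension `M[G] = { val(G, τ) : τ ∈ M }`. -/
noncomputable def genExt (M G : ZFSet) : ZFSet :=
  letI : ∀ (n : ℕ) (f : (Fin n → ZFSet) → ZFSet), ZFSet.Definable n f := fun _ _ => Classical.allZFSetDefinable _
  ZFSet.image (zval G) M

/-- `⟨P, r, one⟩` is a forcing notion belonging to `M`: `r ∈ M` is (the graph of) a preorder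
on `P ∈ M` with greatest element `one`. -/
def ForcingNotion (M P r one : ZFSet) : Prop :=
  P ∈ M ∧ r ∈ M ∧ one ∈ P ∧
    (∀ q ∈ r, ∃ a ∈ P, ∃ b ∈ P, q = ZFSet.pair a b) ∧
    (∀ p ∈ P, ZFSet.pair p p ∈ r) ∧
    (∀ p ∈ P, ∀ q ∈ P, ∀ s ∈ P, ZFSet.pair p q ∈ r → ZFSet.pair q s ∈ r →
      ZFSet.pair p s ∈ r) ∧
    (∀ p ∈ P, ZFSet.pair p one ∈ r)

/-- `D` is a dense subset of the forcing notion `⟨P, r⟩`. -/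
def IsDenseIn (r P D : ZFSet) : Prop :=
  D ⊆ P ∧ ∀ p ∈ P, ∃ d ∈ D, ZFSet.pair d p ∈ r

/-- `G` is a filter on `⟨P, r⟩`: upward closed and downward directed. -/
def IsFilterOn (r P G : ZFSet) : Prop :=
  G ⊆ P ∧ (∀ x ∈ G, ∀ y ∈ P, ZFSet.pair x y ∈ r → y ∈ G) ∧
    (∀ x ∈ G, ∀ y ∈ G, ∃ z ∈ G, ZFSet.pair z x ∈ r ∧ ZFSet.pair z y ∈ r)

/-- `G` is an `M`-generic filter on `⟨P, r⟩`: a filter meeting every dense subset of `P`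
that belongs to `M`. -/
def IsGeneric (M r P G : ZFSet) : Prop :=
  IsFilterOn r P G ∧ ∀ D ∈ M, IsDenseIn r P D → ∃ q ∈ G, q ∈ D


/-! ### Semantic definability -/

/-- The elements of `M`. -/
abbrev U (M : ZFSet) := {x : ZFSet // x ∈ M}

section Realize

attribute [local instance] zfStruct

variable {M : ZFSet} {n : ℕ}

/-- Simultaneous renaming of free variables and constants. -/
def subV {A B : Type} {m n : ℕ} (g : A ⊕ Fin m → B ⊕ Fin n) (φ : SetLang.BoundedFormula A m) :
    SetLang.BoundedFormula B n :=
  (BoundedFormula.relabel g φ.toFormula : SetLang.BoundedFormula B (n + 0))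

theorem rz_subV {A B : Type} {m n : ℕ} (g : A ⊕ Fin m → B ⊕ Fin n)
    (φ : SetLang.BoundedFormula A m) (e : B → U M) (v : Fin n → U M) :
    (subV g φ).Realize e v ↔
      φ.Realize (fun a => Sum.elim e v (g (Sum.inl a))) (fun i => Sum.elim e v (g (Sum.inr i))) := by
  have h := BoundedFormula.realize_toFormula φ (Sum.elim e v ∘ g)
  unfold subV
  rw [BoundedFormula.realize_relabel]
  rw [Subsingleton.elim (v ∘ Fin.natAdd n : Fin 0 → U M) default]
  exact h

theorem rz_mem (i j : Fin n) (e : Empty → U M) (v : Fin n → U M) :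
    (memf i j).Realize e v ↔ (v i).1 ∈ (v j).1 := by
  unfold memf
  rw [BoundedFormula.realize_rel₂]
  rfl

theorem rz_eq (i j : Fin n) (e : Empty → U M) (v : Fin n → U M) :
    (eqf i j).Realize e v ↔ v i = v j := by
  unfold eqf
  rw [BoundedFormula.realize_bdEqual]
  rfl

theorem rz_reindex {m : ℕ} (f : Fin m → Fin n) (φ : BF m) (e : Empty → U M) (v : Fin n → U M) :
    (reindex f φ).Realize e v ↔ φ.Realize e (fun i => v (f i)) :=
  rz_subV (Sum.map id f) φ e v

theorem rz_and (φ ψ : BF n) (e : Empty → U M) (v : Fin n → U M) :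
    (andF φ ψ).Realize e v ↔ φ.Realize e v ∧ ψ.Realize e v := by
  unfold andF; simp

theorem rz_or (φ ψ : BF n) (e : Empty → U M) (v : Fin n → U M) :
    (orF φ ψ).Realize e v ↔ φ.Realize e v ∨ ψ.Realize e v := by
  unfold orF; simp; tauto

theorem rz_iff (φ ψ : BF n) (e : Empty → U M) (v : Fin n → U M) :
    (iffF φ ψ).Realize e v ↔ (φ.Realize e v ↔ ψ.Realize e v) := by
  unfold iffF; simp [rz_and]; tauto

theorem ax_pair (hm : ZModels M ZF) (a b : U M) :
    ∃ c : U M, ∀ x : U M, x.1 ∈ c.1 ↔ x = a ∨ x = b := by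
  have h := hm pairAx (Or.inl (Or.inl (by simp [zfFin])))
  have h2 := h a b
  rw [BoundedFormula.realize_ex] at h2
  obtain ⟨c, hc⟩ := h2
  refine ⟨c, fun x => ?_⟩
  have := hc x
  rw [rz_iff, rz_or, rz_mem, rz_eq, rz_eq] at this
  exact this

theorem ax_union (hm : ZModels M ZF) (a : U M) :
    ∃ c : U M, ∀ x : U M, x.1 ∈ c.1 ↔ ∃ y : U M, y.1 ∈ a.1 ∧ x.1 ∈ y.1 := by
  have h := hm unionAx (Or.inl (Or.inl (by simp [zfFin])))
  have h2 := h a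
  rw [BoundedFormula.realize_ex] at h2
  obtain ⟨c, hc⟩ := h2
  refine ⟨c, fun x => ?_⟩
  have := hc x
  rw [rz_iff, BoundedFormula.realize_ex, rz_mem] at this
  simp only [rz_and, rz_mem] at this
  exact this

theorem ax_pow (hm : ZModels M ZF) (a : U M) :
    ∃ c : U M, ∀ x : U M, x.1 ∈ c.1 ↔ ∀ y : U M, y.1 ∈ x.1 → y.1 ∈ a.1 := by
  have h := hm powAx (Or.inl (Or.inl (by simp [zfFin])))
  have h2 := h a
  rw [BoundedFormula.realize_ex] at h2
  obtain ⟨c, hc⟩ := h2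
  refine ⟨c, fun x => ?_⟩
  have := hc x
  rw [rz_iff, rz_reindex, subF, BoundedFormula.realize_all, rz_mem] at this
  simp only [BoundedFormula.realize_imp, rz_mem] at this
  exact this

theorem ax_sep (hm : ZModels M ZF) (φ : BF (n + 1)) (e : Empty → U M) (v : Fin n → U M) (a : U M) :
    ∃ b : U M, ∀ x : U M, x.1 ∈ b.1 ↔ x.1 ∈ a.1 ∧ φ.Realize e (Fin.snoc v x) := by
  have h := hm (sepAx φ) (Or.inl (Or.inr ⟨⟨n, φ⟩, rfl⟩))
  have h2 := BoundedFormula.realize_alls.1 h v a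
  rw [BoundedFormula.realize_ex] at h2
  obtain ⟨c, hc⟩ := h2
  refine ⟨c, fun x => ?_⟩
  have := hc x
  rw [rz_iff, rz_and, rz_mem, rz_mem, rz_reindex] at this
  convert this using 2
  · simp [Fin.snoc]
  · simp [Fin.snoc]
  · simp [Fin.snoc]
  · rw [Subsingleton.elim e default]
    apply iff_of_eq; congr 1
    funext i
    by_cases hi : (i : ℕ) < n
    · have : (i : ℕ) < n + 1 + 1 := by omega
      have : (i : ℕ) < n + 1 := by omega
      simp [Fin.snoc, *]
    · simp [Fin.snoc, hi]

theorem ax_repl (hm : ZModels M ZF) (φ : BF (n + 2)) (e : Empty → U M) (v : Fin n → U M) (a : U M)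
    (hf : ∀ x y y' : U M, x.1 ∈ a.1 → φ.Realize e (Fin.snoc (Fin.snoc v x : Fin (n + 1) → U M) y) →
      φ.Realize e (Fin.snoc (Fin.snoc v x : Fin (n + 1) → U M) y') → y = y') :
    ∃ b : U M, ∀ y : U M, y.1 ∈ b.1 ↔
      ∃ x : U M, x.1 ∈ a.1 ∧ φ.Realize e (Fin.snoc (Fin.snoc v x : Fin (n + 1) → U M) y) := by
  have h := hm (replAx φ) (Or.inr ⟨⟨n, φ⟩, rfl⟩)
  have h2 := BoundedFormula.realize_alls.1 h v a
  rw [Subsingleton.elim e default] at *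
  rw [BoundedFormula.realize_imp, BoundedFormula.realize_ex] at h2
  have key : ∀ (w : Fin (n + 4) → U M) (f : Fin (n + 2) → Fin (n + 4)) (x y : U M),
      (∀ i : Fin (n + 2), w (f i) = (Fin.snoc (Fin.snoc v x : Fin (n + 1) → U M) y : Fin (n + 2) → U M) i) →
      ((reindex f φ).Realize default w ↔
        φ.Realize default (Fin.snoc (Fin.snoc v x : Fin (n + 1) → U M) y)) := by
    intro w f x y hw
    rw [rz_reindex]
    apply iff_of_eq; congr 1; funext i; exact hw i
  obtain ⟨c, hc⟩ := h2 (by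
    intro x y y' hh
    rw [rz_and, rz_and, rz_mem, key _ _ x y, key _ _ x y'] at hh
    · rw [rz_eq]
      have := hf x y y' (by simpa [Fin.snoc, show n ≤ n + 1 + 1 by omega, show n < n + 1 + 1 + 1 by omega] using hh.1) hh.2.1 hh.2.2
      simpa [Fin.snoc] using this
    · intro i
      rcases lt_trichotomy (i : ℕ) n with hi | hi | hi
      · have : (i : ℕ) < n + 1 := by omega
        have : (i : ℕ) < n + 1 + 1 := by omega
        have : (i : ℕ) < n + 1 + 1 + 1 := by omega
        simp [Fin.snoc, *]
      · simp [Fin.snoc, hi]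
      · have h1 : ¬ (i : ℕ) < n := by omega
        have h2 : ¬ (i : ℕ) = n := by omega
        have h3 : ¬ (i : ℕ) < n + 1 := by omega
        simp [Fin.snoc, h1, h2, h3]
    · intro i
      rcases lt_trichotomy (i : ℕ) n with hi | hi | hi
      · have : (i : ℕ) < n + 1 := by omega
        have : (i : ℕ) < n + 1 + 1 := by omega
        have : (i : ℕ) < n + 1 + 1 + 1 := by omega
        simp [Fin.snoc, *]
      · simp [Fin.snoc, hi]
      · have h1 : ¬ (i : ℕ) < n := by omega
        have h2 : ¬ (i : ℕ) = n := by omega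
        have h3 : ¬ (i : ℕ) < n + 1 := by omega
        simp [Fin.snoc, h1, h2, h3])
  refine ⟨c, fun y => ?_⟩
  have := hc y
  rw [rz_iff, BoundedFormula.realize_ex, rz_mem] at this
  convert this using 2
  · simp [Fin.snoc]
  · simp [Fin.snoc]
  · funext x
    apply propext
    rw [rz_and, rz_mem, key _ _ x y]
    · simp [Fin.snoc, show n < n + 1 + 1 + 1 by omega]
    · intro i
      rcases lt_trichotomy (i : ℕ) n with hi | hi | hi
      · have : (i : ℕ) < n + 1 := by omega
        have : (i : ℕ) < n + 1 + 1 := by omega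
        have : (i : ℕ) < n + 1 + 1 + 1 := by omega
        simp [Fin.snoc, *]
      · simp [Fin.snoc, hi]
      · have h1 : ¬ (i : ℕ) < n := by omega
        have h2 : ¬ (i : ℕ) = n := by omega
        have h3 : ¬ (i : ℕ) < n + 1 := by omega
        simp [Fin.snoc, h1, h2, h3]

end Realize

section Dfn

attribute [local instance] zfStruct

variable {M : ZFSet} {k n : ℕ} {c : Fin k → U M}

/-- `R` is definable over `M` with constants `c`. -/
def Dfn (c : Fin k → U M) (R : (Fin n → U M) → Prop) : Prop :=
  ∃ φ : SetLang.BoundedFormula (Fin k) n, ∀ v, φ.Realize c v ↔ R v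

/-- `f` is a variable or a constant. -/
def IsTm (c : Fin k → U M) (f : (Fin n → U M) → U M) : Prop :=
  ∃ t : Fin k ⊕ Fin n, ∀ v, f v = Sum.elim c v t

theorem IsTm.var (i : Fin n) : IsTm c (fun v : Fin n → U M => v i) := ⟨Sum.inr i, fun _ => rfl⟩

theorem IsTm.cst {a : U M} (h : ∃ i, c i = a) : IsTm c (fun _ : Fin n → U M => a) := by
  obtain ⟨i, rfl⟩ := h
  exact ⟨Sum.inl i, fun _ => rfl⟩

theorem Dfn.congr {R S : (Fin n → U M) → Prop} (h : Dfn c S) (hRS : ∀ v, R v ↔ S v) : Dfn c R := by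
  obtain ⟨φ, hφ⟩ := h
  exact ⟨φ, fun v => (hφ v).trans (hRS v).symm⟩

theorem Dfn.fls : Dfn c (fun _ : Fin n → U M => False) := ⟨⊥, fun v => by simp⟩

theorem Dfn.imp {R S : (Fin n → U M) → Prop} (hR : Dfn c R) (hS : Dfn c S) :
    Dfn c (fun v => R v → S v) := by
  obtain ⟨φ, hφ⟩ := hR
  obtain ⟨ψ, hψ⟩ := hS
  exact ⟨φ.imp ψ, fun v => by rw [BoundedFormula.realize_imp, hφ, hψ]⟩

theorem Dfn.not {R : (Fin n → U M) → Prop} (hR : Dfn c R) : Dfn c (fun v => ¬ R v) :=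
  hR.imp Dfn.fls

theorem Dfn.and {R S : (Fin n → U M) → Prop} (hR : Dfn c R) (hS : Dfn c S) :
    Dfn c (fun v => R v ∧ S v) :=
  (hR.imp hS.not).not.congr fun v => by tauto

theorem Dfn.or {R S : (Fin n → U M) → Prop} (hR : Dfn c R) (hS : Dfn c S) :
    Dfn c (fun v => R v ∨ S v) :=
  (hR.not.imp hS).congr fun v => by tauto

theorem Dfn.iff {R S : (Fin n → U M) → Prop} (hR : Dfn c R) (hS : Dfn c S) :
    Dfn c (fun v => R v ↔ S v) :=
  ((hR.imp hS).and (hS.imp hR)).congr fun v => by tauto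

theorem Dfn.all {R : (Fin n → U M) → U M → Prop}
    (hR : Dfn c (fun w : Fin (n + 1) → U M => R (fun i => w i.castSucc) (w (Fin.last n)))) :
    Dfn c (fun v => ∀ x, R v x) := by
  obtain ⟨φ, hφ⟩ := hR
  refine ⟨φ.all, fun v => ?_⟩
  rw [BoundedFormula.realize_all]
  refine forall_congr' fun x => ?_
  rw [hφ]
  simp

theorem Dfn.ex {R : (Fin n → U M) → U M → Prop}
    (hR : Dfn c (fun w : Fin (n + 1) → U M => R (fun i => w i.castSucc) (w (Fin.last n)))) :
    Dfn c (fun v => ∃ x, R v x) :=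
  (Dfn.all (R := fun v x => ¬ R v x) hR.not).not.congr fun v => by simp

theorem Dfn.mem {f g : (Fin n → U M) → U M} (hf : IsTm c f) (hg : IsTm c g) :
    Dfn c (fun v => (f v).1 ∈ (g v).1) := by
  obtain ⟨s, hs⟩ := hf
  obtain ⟨t, ht⟩ := hg
  refine ⟨memSymb.boundedFormula₂ (Term.var s) (Term.var t), fun v => ?_⟩
  rw [BoundedFormula.realize_rel₂]
  beta_reduce
  rw [hs, ht]
  rfl

theorem Dfn.eq {f g : (Fin n → U M) → U M} (hf : IsTm c f) (hg : IsTm c g) :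
    Dfn c (fun v => f v = g v) := by
  obtain ⟨s, hs⟩ := hf
  obtain ⟨t, ht⟩ := hg
  refine ⟨Term.bdEqual (Term.var s) (Term.var t), fun v => ?_⟩
  rw [BoundedFormula.realize_bdEqual]
  beta_reduce
  rw [hs, ht]
  rfl

theorem Dfn.subst {m : ℕ} {R : (Fin m → U M) → Prop} (hR : Dfn c R)
    (t : Fin m → (Fin n → U M) → U M) (ht : ∀ i, IsTm c (t i)) :
    Dfn c (fun v => R (fun i => t i v)) := by
  obtain ⟨φ, hφ⟩ := hR
  choose s hs using ht
  refine ⟨subV (Sum.elim Sum.inl s) φ, fun v => ?_⟩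
  beta_reduce
  rw [rz_subV, ← hφ]
  simp [hs]

theorem Dfn.subst2 {R : U M → U M → Prop} (hR : Dfn c (fun v : Fin 2 → U M => R (v 0) (v 1)))
    {f g : (Fin n → U M) → U M} (hf : IsTm c f) (hg : IsTm c g) :
    Dfn c (fun v => R (f v) (g v)) :=
  hR.subst ![f, g] (by intro i; fin_cases i; exacts [hf, hg])

theorem Dfn.subst3 {R : U M → U M → U M → Prop}
    (hR : Dfn c (fun v : Fin 3 → U M => R (v 0) (v 1) (v 2)))
    {f g h : (Fin n → U M) → U M} (hf : IsTm c f) (hg : IsTm c g) (hh : IsTm c h) :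
    Dfn c (fun v => R (f v) (g v) (h v)) :=
  hR.subst ![f, g, h] (by intro i; fin_cases i; exacts [hf, hg, hh])

theorem Dfn.subst4 {R : U M → U M → U M → U M → Prop}
    (hR : Dfn c (fun v : Fin 4 → U M => R (v 0) (v 1) (v 2) (v 3)))
    {f g h l : (Fin n → U M) → U M} (hf : IsTm c f) (hg : IsTm c g) (hh : IsTm c h)
    (hl : IsTm c l) :
    Dfn c (fun v => R (f v) (g v) (h v) (l v)) :=
  hR.subst ![f, g, h, l] (by intro i; fin_cases i; exacts [hf, hg, hh, hl])

/-- Turn constants into variables. -/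
theorem Dfn.toBF {R : (Fin n → U M) → Prop} (hR : Dfn c R) :
    ∃ φ : BF (k + n), ∀ (e : Empty → U M) (v : Fin n → U M),
      φ.Realize e (Fin.append c v) ↔ R v := by
  obtain ⟨φ, hφ⟩ := hR
  refine ⟨subV (fun s => Sum.inr (finSumFinEquiv s)) φ, fun e v => ?_⟩
  rw [rz_subV, ← hφ]
  simp

theorem sep_of_dfn (hm : ZModels M ZF) {R : U M → Prop}
    (hR : Dfn c (fun v : Fin 1 → U M => R (v 0))) (a : U M) :
    ∃ b : U M, ∀ x : U M, x.1 ∈ b.1 ↔ x.1 ∈ a.1 ∧ R x := by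
  obtain ⟨φ, hφ⟩ := hR.toBF
  obtain ⟨b, hb⟩ := ax_sep hm φ Empty.elim c a
  refine ⟨b, fun x => ?_⟩
  rw [hb, ← hφ Empty.elim (fun _ => x)]
  rw [Fin.append_right_eq_snoc]

theorem repl_of_dfn (hm : ZModels M ZF) {R : U M → U M → Prop}
    (hR : Dfn c (fun v : Fin 2 → U M => R (v 0) (v 1))) (a : U M)
    (hf : ∀ x y y', x.1 ∈ a.1 → R x y → R x y' → y = y') :
    ∃ b : U M, ∀ y : U M, y.1 ∈ b.1 ↔ ∃ x : U M, x.1 ∈ a.1 ∧ R x y := by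
  obtain ⟨φ, hφ⟩ := hR.toBF
  have key : ∀ x y, φ.Realize Empty.elim (Fin.snoc (Fin.snoc c x : Fin (k + 1) → U M) y) ↔ R x y := by
    intro x y
    refine Iff.trans ?_ (hφ Empty.elim ![x, y])
    have : (Fin.append c ![x, y]) = Fin.snoc (Fin.snoc c x : Fin (k + 1) → U M) y := by
      rw [← Fin.append_right_eq_snoc c (fun _ => x), ← Fin.append_right_eq_snoc _ (fun _ => y)]
      rw [Fin.append_assoc]
      funext i
      refine Fin.addCases (fun i => ?_) (fun i => ?_) i
      · simp
      · fin_cases i <;> simp <;> rfl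
    rw [this]
  obtain ⟨b, hb⟩ := ax_repl hm φ Empty.elim c a (fun x y y' hx h1 h2 =>
    hf x y y' hx ((key x y).1 h1) ((key x y').1 h2))
  refine ⟨b, fun y => ?_⟩
  rw [hb]
  simp only [key]

end Dfn

section Model

variable {M : ZFSet} {k n : ℕ} {c : Fin k → U M}

theorem m_up (ht : M.IsTransitive) {x y : ZFSet} (hy : y ∈ M) (hx : x ∈ y) : x ∈ M :=
  ht y hy hx

theorem m_upair (ht : M.IsTransitive) (hm : ZModels M ZF) {a b : ZFSet} (ha : a ∈ M) (hb : b ∈ M) :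
    ({a, b} : ZFSet) ∈ M := by
  obtain ⟨z, hz⟩ := ax_pair hm ⟨a, ha⟩ ⟨b, hb⟩
  have : ({a, b} : ZFSet) = z.1 := by
    ext x
    rw [ZFSet.mem_pair]
    constructor
    · rintro (rfl | rfl)
      · exact (hz ⟨x, ha⟩).2 (Or.inl rfl)
      · exact (hz ⟨x, hb⟩).2 (Or.inr rfl)
    · intro hx
      have := (hz ⟨x, m_up ht z.2 hx⟩).1 hx
      simpa using this
  rw [this]
  exact z.2

theorem m_sing (ht : M.IsTransitive) (hm : ZModels M ZF) {a : ZFSet} (ha : a ∈ M) :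
    ({a} : ZFSet) ∈ M := by
  have h := m_upair ht hm ha ha
  have : ({a, a} : ZFSet) = {a} := by ext; simp
  rwa [this] at h

theorem m_pair (ht : M.IsTransitive) (hm : ZModels M ZF) {a b : ZFSet} (ha : a ∈ M) (hb : b ∈ M) :
    ZFSet.pair a b ∈ M :=
  m_upair ht hm (m_sing ht hm ha) (m_upair ht hm ha hb)

theorem m_union (ht : M.IsTransitive) (hm : ZModels M ZF) {a : ZFSet} (ha : a ∈ M) :
    ZFSet.sUnion a ∈ M := by
  obtain ⟨z, hz⟩ := ax_union hm ⟨a, ha⟩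
  have : ZFSet.sUnion a = z.1 := by
    ext x
    rw [ZFSet.mem_sUnion]
    constructor
    · rintro ⟨y, hy, hx⟩
      exact (hz ⟨x, m_up ht (m_up ht ha hy) hx⟩).2 ⟨⟨y, m_up ht ha hy⟩, hy, hx⟩
    · intro hx
      obtain ⟨y, hy, hx⟩ := (hz ⟨x, m_up ht z.2 hx⟩).1 hx
      exact ⟨y, hy, hx⟩
  rw [this]
  exact z.2

theorem m_union2 (ht : M.IsTransitive) (hm : ZModels M ZF) {a b : ZFSet} (ha : a ∈ M) (hb : b ∈ M) :
    a ∪ b ∈ M := by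
  rw [← ZFSet.sUnion_pair]
  exact m_union ht hm (m_upair ht hm ha hb)

theorem m_pow (ht : M.IsTransitive) (hm : ZModels M ZF) {a : ZFSet} (ha : a ∈ M) :
    ∃ b ∈ M, ∀ x ∈ M, x ⊆ a → x ∈ b := by
  obtain ⟨z, hz⟩ := ax_pow hm ⟨a, ha⟩
  exact ⟨z, z.2, fun x hx hxa => (hz ⟨x, hx⟩).2 fun y hy => hxa hy⟩

theorem m_prod (ht : M.IsTransitive) (hm : ZModels M ZF) {a : ZFSet} (ha : a ∈ M) :
    ∃ b ∈ M, a ⊆ b ∧ ∀ x ∈ a, ∀ y ∈ a, ZFSet.pair x y ∈ b := by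
  obtain ⟨b, hb, hb'⟩ := m_pow ht hm ha
  obtain ⟨d, hd, hd'⟩ := m_pow ht hm hb
  refine ⟨a ∪ d, m_union2 ht hm ha hd, fun x hx => ZFSet.mem_union.2 (Or.inl hx), ?_⟩
  intro x hx y hy
  have hxM := m_up ht ha hx
  have hyM := m_up ht ha hy
  refine ZFSet.mem_union.2 (Or.inr (hd' _ (m_pair ht hm hxM hyM) ?_))
  intro z hz
  rw [ZFSet.pair, ZFSet.mem_pair] at hz
  rcases hz with rfl | rfl
  · refine hb' _ (m_sing ht hm hxM) fun w hw => ?_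
    rw [ZFSet.mem_singleton] at hw
    rwa [hw]
  · refine hb' _ (m_upair ht hm hxM hyM) fun w hw => ?_
    rw [ZFSet.mem_pair] at hw
    rcases hw with rfl | rfl <;> assumption

/-- `T` is the least transitive set containing `x`, inside `M`. -/
def IsTC (x T : U M) : Prop :=
  (∀ y : U M, y.1 ∈ T.1 → ∀ z : U M, z.1 ∈ y.1 → z.1 ∈ T.1) ∧ x.1 ∈ T.1 ∧
    ∀ S : U M, (∀ y : U M, y.1 ∈ S.1 → ∀ z : U M, z.1 ∈ y.1 → z.1 ∈ S.1) → x.1 ∈ S.1 →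
      ∀ y : U M, y.1 ∈ T.1 → y.1 ∈ S.1

theorem dfn_IsTC : Dfn c (fun v : Fin 2 → U M => IsTC (v 0) (v 1)) := by
  unfold IsTC
  repeat' first
    | exact IsTm.var _
    | apply Dfn.mem
    | apply Dfn.and
    | apply Dfn.all
    | apply Dfn.imp

theorem m_tc (ht : M.IsTransitive) (hm : ZModels M ZF) (x : ZFSet) :
    ∀ hx : x ∈ M, ∃ T : U M, IsTC ⟨x, hx⟩ T := by
  refine ZFSet.inductionOn x ?_
  intro x ih hx
  have huniq : ∀ y T T' : U M, IsTC y T → IsTC y T' → T = T' := by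
    intro y T T' h h'
    apply Subtype.ext
    ext z
    constructor
    · intro hz
      exact h.2.2 T' h'.1 h'.2.1 ⟨z, m_up ht T.2 hz⟩ hz
    · intro hz
      exact h'.2.2 T h.1 h.2.1 ⟨z, m_up ht T'.2 hz⟩ hz
  obtain ⟨b, hb⟩ := repl_of_dfn hm (dfn_IsTC (c := (Fin.elim0 : Fin 0 → U M))) ⟨x, hx⟩
    (fun y T T' _ => huniq y T T')
  refine ⟨⟨{x} ∪ ZFSet.sUnion b.1, m_union2 ht hm (m_sing ht hm hx) (m_union ht hm b.2)⟩, ?_, ?_, ?_⟩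
  · rintro ⟨y, hyM⟩ hy ⟨z, hzM⟩ hz
    dsimp only at hy hz ⊢
    rw [ZFSet.mem_union, ZFSet.mem_singleton, ZFSet.mem_sUnion] at hy ⊢
    right
    rcases hy with rfl | ⟨T, hT, hy⟩
    · obtain ⟨T, hT⟩ := ih z hz hzM
      exact ⟨T.1, (hb T).2 ⟨⟨z, hzM⟩, hz, hT⟩, hT.2.1⟩
    · obtain ⟨w, hw, hT'⟩ := (hb ⟨T, m_up ht b.2 hT⟩).1 hT
      exact ⟨T, hT, hT'.1 ⟨y, hyM⟩ hy ⟨z, hzM⟩ hz⟩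
  · simp
  · rintro S hS hxS ⟨y, hyM⟩ hy
    dsimp only at hy hxS ⊢
    rw [ZFSet.mem_union, ZFSet.mem_singleton, ZFSet.mem_sUnion] at hy
    rcases hy with rfl | ⟨T, hT, hy⟩
    · exact hxS
    · obtain ⟨w, hw, hT'⟩ := (hb ⟨T, m_up ht b.2 hT⟩).1 hT
      exact hT'.2.2 S hS (hS ⟨x, hx⟩ hxS w hw) ⟨y, hyM⟩ hy

/-- A set in `M` closed under everything in sight. -/
theorem m_big (ht : M.IsTransitive) (hm : ZModels M ZF) {x : ZFSet} (hx : x ∈ M) :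
    ∃ T ∈ M, x ∈ T ∧ T.IsTransitive ∧ ∃ A ∈ M, ∀ p ∈ T, ∀ s ∈ T, ∀ t ∈ T,
      ZFSet.pair (ZFSet.pair p s) t ∈ A := by
  obtain ⟨T, hT⟩ := m_tc ht hm x hx
  obtain ⟨B, hB, hTB, hB'⟩ := m_prod ht hm T.2
  obtain ⟨A, hA, -, hA'⟩ := m_prod ht hm hB
  refine ⟨T.1, T.2, hT.2.1, ?_, A, hA, ?_⟩
  · intro y hy z hz
    have hyM := m_up ht T.2 hy
    exact hT.1 ⟨y, hyM⟩ hy ⟨z, m_up ht hyM hz⟩ hz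
  · intro p hp s hs t ht
    exact hA' _ (hB' _ hp _ hs) _ (hTB ht)

/-- `z = {x, y}`. -/
def IsUp (x y z : U M) : Prop := ∀ w : U M, w.1 ∈ z.1 ↔ w = x ∨ w = y

/-- `⟨x, y⟩ ∈ z`. -/
def In (x y z : U M) : Prop := ZFSet.pair x.1 y.1 ∈ z.1

/-- `⟨⟨p, s⟩, t⟩ ∈ E`. -/
def Tr (E p s t : U M) : Prop := ZFSet.pair (ZFSet.pair p.1 s.1) t.1 ∈ E.1

theorem isUp_iff (ht : M.IsTransitive) (x y z : U M) : IsUp x y z ↔ z.1 = {x.1, y.1} := by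
  constructor
  · intro h
    ext w
    rw [ZFSet.mem_pair]
    constructor
    · intro hw
      have := (h ⟨w, m_up ht z.2 hw⟩).1 hw
      rcases this with h | h
      · exact Or.inl (congrArg Subtype.val h)
      · exact Or.inr (congrArg Subtype.val h)
    · rintro (rfl | rfl)
      · exact (h x).2 (Or.inl rfl)
      · exact (h y).2 (Or.inr rfl)
  · intro h w
    rw [h, ZFSet.mem_pair, Subtype.ext_iff, Subtype.ext_iff]

theorem dfn_IsUp : Dfn c (fun v : Fin 3 → U M => IsUp (v 0) (v 1) (v 2)) := by
  unfold IsUp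
  repeat' first
    | exact IsTm.var _
    | apply Dfn.mem
    | apply Dfn.eq
    | apply Dfn.or
    | apply Dfn.iff
    | apply Dfn.all

theorem dfn_isPair (ht : M.IsTransitive) (hm : ZModels M ZF) :
    Dfn c (fun v : Fin 3 → U M => (v 2).1 = ZFSet.pair (v 0).1 (v 1).1) := by
  have h : Dfn c (fun v : Fin 3 → U M => ∃ a b : U M, IsUp (v 0) (v 0) a ∧ IsUp (v 0) (v 1) b ∧
      IsUp a b (v 2)) := by
    repeat' first
      | exact IsTm.var _
      | apply Dfn.subst3 dfn_IsUp
      | apply Dfn.and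
      | apply Dfn.ex
  refine h.congr fun v => ?_
  simp only [isUp_iff ht]
  have hs : ∀ a : ZFSet, ({a, a} : ZFSet) = {a} := by intro a; ext; simp
  rw [hs]
  constructor
  · intro h
    exact ⟨⟨{(v 0).1}, m_sing ht hm (v 0).2⟩, ⟨{(v 0).1, (v 1).1}, m_upair ht hm (v 0).2 (v 1).2⟩,
      rfl, rfl, h⟩
  · rintro ⟨a, b, ha, hb, h⟩
    rw [h, ha, hb]
    rfl

theorem dfn_In (ht : M.IsTransitive) (hm : ZModels M ZF) :
    Dfn c (fun v : Fin 3 → U M => In (v 0) (v 1) (v 2)) := by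
  have h : Dfn c (fun v : Fin 3 → U M => ∃ a : U M, a.1 = ZFSet.pair (v 0).1 (v 1).1 ∧
      a.1 ∈ (v 2).1) := by
    repeat' first
      | exact IsTm.var _
      | apply Dfn.subst3 (R := fun x y z => z.1 = ZFSet.pair x.1 y.1) (dfn_isPair ht hm)
      | apply Dfn.mem
      | apply Dfn.and
      | apply Dfn.ex
  refine h.congr fun v => ?_
  constructor
  · intro h
    exact ⟨⟨_, m_up ht (v 2).2 h⟩, rfl, h⟩
  · rintro ⟨a, ha, h⟩
    rw [ha] at h
    exact h

theorem dfn_Tr (ht : M.IsTransitive) (hm : ZModels M ZF) :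
    Dfn c (fun v : Fin 4 → U M => Tr (v 0) (v 1) (v 2) (v 3)) := by
  have h : Dfn c (fun v : Fin 4 → U M => ∃ a : U M, a.1 = ZFSet.pair (v 1).1 (v 2).1 ∧
      In a (v 3) (v 0)) := by
    repeat' first
      | exact IsTm.var _
      | apply Dfn.subst3 (R := fun x y z => z.1 = ZFSet.pair x.1 y.1) (dfn_isPair ht hm)
      | apply Dfn.subst3 (dfn_In ht hm)
      | apply Dfn.mem
      | apply Dfn.and
      | apply Dfn.ex
  refine h.congr fun v => ?_
  constructor
  · intro h
    exact ⟨⟨_, m_pair ht hm (v 1).2 (v 2).2⟩, rfl, h⟩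
  · rintro ⟨a, ha, h⟩
    unfold In at h
    rw [ha] at h
    exact h

theorem m_up_pair (ht : M.IsTransitive) {a b z : ZFSet} (hz : z ∈ M) (h : ZFSet.pair a b ∈ z) :
    a ∈ M ∧ b ∈ M := by
  have h1 := m_up ht hz h
  have h2 : ({a, b} : ZFSet) ∈ M := m_up ht h1 (by rw [ZFSet.pair, ZFSet.mem_pair]; exact Or.inr rfl)
  exact ⟨m_up ht h2 (by simp), m_up ht h2 (by simp)⟩

end Model

section Atomic

variable {M : ZFSet} {k n : ℕ} {c : Fin k → U M} {r : U M}

/-- One half of the forcing bisimulation clause. -/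
def Half (r : U M) (X : U M → U M → U M → Prop) (p σ τ : U M) : Prop :=
  ∀ σ' s : U M, In σ' s σ → ∀ q : U M, In q p r → ∃ q' : U M, In q' q r ∧
    (In q' s r → ∃ τ' t : U M, In τ' t τ ∧ In q' t r ∧ X q' σ' τ')

/-- The forcing bisimulation clause. -/
def Phi (r : U M) (X : U M → U M → U M → Prop) (p σ τ : U M) : Prop :=
  Half r X p σ τ ∧ Half r X p τ σ

/-- Forcing of equality. -/
def Est (r : U M) (p σ τ : U M) : Prop :=
  ∃ E : U M, (∀ p σ τ : U M, Tr E p σ τ → Phi r (Tr E) p σ τ) ∧ Tr E p σ τ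

theorem Phi.mono {X Y : U M → U M → U M → Prop} {p σ τ : U M}
    (h : ∀ q σ' τ' s t, In σ' s σ → In τ' t τ → In q t r → X q σ' τ' → Y q σ' τ')
    (h' : ∀ q σ' τ' s t, In σ' s σ → In τ' t τ → In q s r → X q τ' σ' → Y q τ' σ')
    (hX : Phi r X p σ τ) : Phi r Y p σ τ := by
  constructor
  · intro σ' s hs q hq
    obtain ⟨q', h1, h2⟩ := hX.1 σ' s hs q hq
    refine ⟨q', h1, fun h3 => ?_⟩
    obtain ⟨τ', t, h4, h5, h6⟩ := h2 h3
    exact ⟨τ', t, h4, h5, h _ _ _ _ _ hs h4 h5 h6⟩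
  · intro σ' s hs q hq
    obtain ⟨q', h1, h2⟩ := hX.2 σ' s hs q hq
    refine ⟨q', h1, fun h3 => ?_⟩
    obtain ⟨τ', t, h4, h5, h6⟩ := h2 h3
    exact ⟨τ', t, h4, h5, h' _ _ _ _ _ h4 hs h5 h6⟩

theorem Est.phi {p σ τ : U M} (h : Est r p σ τ) : Phi r (Est r) p σ τ := by
  obtain ⟨E, hE, h⟩ := h
  exact (hE _ _ _ h).mono (fun q σ' τ' _ _ _ _ _ h => ⟨E, hE, h⟩) (fun q σ' τ' _ _ _ _ _ h => ⟨E, hE, h⟩)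

theorem dfn_Half (ht : M.IsTransitive) (hm : ZModels M ZF) (hr : ∃ i, c i = r)
    {X : U M → U M → U M → U M → Prop}
    (hX : Dfn c (fun v : Fin 4 → U M => X (v 0) (v 1) (v 2) (v 3))) :
    Dfn c (fun v : Fin 4 → U M => Half r (X (v 0)) (v 1) (v 2) (v 3)) := by
  unfold Half
  repeat' first
    | exact IsTm.var _
    | exact IsTm.cst hr
    | apply Dfn.subst4 hX
    | apply Dfn.subst3 (dfn_In ht hm)
    | apply Dfn.and
    | apply Dfn.ex
    | apply Dfn.all
    | apply Dfn.imp

theorem dfn_Phi (ht : M.IsTransitive) (hm : ZModels M ZF) (hr : ∃ i, c i = r)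
    {X : U M → U M → U M → U M → Prop}
    (hX : Dfn c (fun v : Fin 4 → U M => X (v 0) (v 1) (v 2) (v 3))) :
    Dfn c (fun v : Fin 4 → U M => Phi r (X (v 0)) (v 1) (v 2) (v 3)) := by
  unfold Phi
  apply Dfn.and
  · exact dfn_Half ht hm hr hX
  · exact Dfn.subst4 (R := fun a b c d => Half r (X a) b c d) (dfn_Half ht hm hr hX)
      (IsTm.var _) (IsTm.var _) (IsTm.var _) (IsTm.var _)

theorem dfn_Est (ht : M.IsTransitive) (hm : ZModels M ZF) (hr : ∃ i, c i = r) :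
    Dfn c (fun v : Fin 3 → U M => Est r (v 0) (v 1) (v 2)) := by
  unfold Est
  repeat' first
    | exact IsTm.var _
    | exact IsTm.cst hr
    | apply Dfn.subst4 (R := fun a b c d => Phi r (Tr a) b c d) (dfn_Phi ht hm hr (dfn_Tr ht hm))
    | apply Dfn.subst4 (dfn_Tr ht hm)
    | apply Dfn.and
    | apply Dfn.ex
    | apply Dfn.all
    | apply Dfn.imp

theorem dfn_PhiEst (ht : M.IsTransitive) (hm : ZModels M ZF) (hr : ∃ i, c i = r) :
    Dfn c (fun v : Fin 3 → U M => Phi r (Est r) (v 0) (v 1) (v 2)) := by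
  have h := dfn_Phi ht hm hr (X := fun _ => Est r) (by
    exact Dfn.subst3 (dfn_Est ht hm hr) (IsTm.var _) (IsTm.var _) (IsTm.var _))
  exact Dfn.subst4 (R := fun _ b c d => Phi r (Est r) b c d) h
      (IsTm.var 0) (IsTm.var _) (IsTm.var _) (IsTm.var _)

theorem Est.of_phi (ht : M.IsTransitive) (hm : ZModels M ZF) {P : U M}
    (hrP : ∀ a b : U M, In a b r → a.1 ∈ P.1)
    {p σ τ : U M} (h : Phi r (Est r) p σ τ) : Est r p σ τ := by
  obtain ⟨T, hT, hx, hTt, A, hA, hTA⟩ := m_big ht hm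
    (m_upair ht hm (m_upair ht hm P.2 p.2) (m_upair ht hm σ.2 τ.2))
  have up : ∀ {a b : ZFSet}, b ∈ T → a ∈ b → a ∈ T := fun hb ha => hTt _ hb ha
  have h1 : ({P.1, p.1} : ZFSet) ∈ T := up hx (by simp)
  have h2 : ({σ.1, τ.1} : ZFSet) ∈ T := up hx (by simp)
  have hP : P.1 ∈ T := up h1 (by simp)
  have hp : p.1 ∈ T := up h1 (by simp)
  have hσ : σ.1 ∈ T := up h2 (by simp)
  have hτ : τ.1 ∈ T := up h2 (by simp)
  have up2 : ∀ {a b z : U M}, z.1 ∈ T → In a b z → a.1 ∈ T := by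
    intro a b z hz hab
    have h3 : ({a.1, b.1} : ZFSet) ∈ T := up (up hz hab) (by simp [ZFSet.pair])
    exact up h3 (by simp)
  let c : Fin 2 → U M := ![r, ⟨T, hT⟩]
  have hr : ∃ i, c i = r := ⟨0, rfl⟩
  have hTc : ∃ i, c i = ⟨T, hT⟩ := ⟨1, rfl⟩
  have hd : Dfn c (fun v : Fin 1 → U M => ∃ p s t : U M, p.1 ∈ (⟨T, hT⟩ : U M).1 ∧
      s.1 ∈ (⟨T, hT⟩ : U M).1 ∧ t.1 ∈ (⟨T, hT⟩ : U M).1 ∧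
      (∃ a : U M, a.1 = ZFSet.pair p.1 s.1 ∧ (v 0).1 = ZFSet.pair a.1 t.1) ∧
      Phi r (Est r) p s t) := by
    repeat' first
      | exact IsTm.var _
      | exact IsTm.cst hTc
      | apply Dfn.subst3 (R := fun a b c => Phi r (Est r) a b c) (dfn_PhiEst ht hm hr)
      | apply Dfn.subst3 (R := fun x y z => z.1 = ZFSet.pair x.1 y.1) (dfn_isPair ht hm)
      | apply Dfn.mem
      | apply Dfn.and
      | apply Dfn.ex
  obtain ⟨E, hE⟩ := sep_of_dfn hm (R := fun x => ∃ p s t : U M, p.1 ∈ T ∧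
      s.1 ∈ T ∧ t.1 ∈ T ∧
      (∃ a : U M, a.1 = ZFSet.pair p.1 s.1 ∧ x.1 = ZFSet.pair a.1 t.1) ∧
      Phi r (Est r) p s t) hd ⟨A, hA⟩
  have hTr : ∀ p s t : U M, Tr E p s t ↔ p.1 ∈ T ∧ s.1 ∈ T ∧ t.1 ∈ T ∧ Phi r (Est r) p s t := by
    intro p s t
    unfold Tr
    constructor
    · intro h
      obtain ⟨-, p', s', t', hp, hs, ht', ⟨a, ha, ha'⟩, hphi⟩ := (hE ⟨_, m_up ht E.2 h⟩).1 h
      dsimp only at ha'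
      rw [ha, ZFSet.pair_inj, ZFSet.pair_inj] at ha'
      obtain ⟨⟨e1, e2⟩, e3⟩ := ha'
      obtain rfl := Subtype.ext e1
      obtain rfl := Subtype.ext e2
      obtain rfl := Subtype.ext e3
      exact ⟨hp, hs, ht', hphi⟩
    · rintro ⟨hp, hs, ht', hphi⟩
      have hps := m_pair ht hm p.2 s.2
      exact (hE ⟨_, m_pair ht hm hps t.2⟩).2 ⟨hTA _ hp _ hs _ ht', p, s, t, hp, hs, ht',
        ⟨⟨_, hps⟩, rfl, rfl⟩, hphi⟩
  refine ⟨E, fun p σ τ h => ?_, (hTr _ _ _).2 ⟨hp, hσ, hτ, h⟩⟩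
  obtain ⟨hp, hσ, hτ, h⟩ := (hTr _ _ _).1 h
  refine h.mono ?_ ?_
  · intro q σ' τ' s t hs ht hq hest
    exact (hTr _ _ _).2 ⟨up hP (hrP _ _ hq), up2 hσ hs, up2 hτ ht, hest.phi⟩
  · intro q σ' τ' s t hs ht hq hest
    exact (hTr _ _ _).2 ⟨up hP (hrP _ _ hq), up2 hτ ht, up2 hσ hs, hest.phi⟩

end Atomic

section Generic

variable {M : ZFSet} {k n : ℕ} {c : Fin k → U M} {P r : U M} {one : ZFSet}

theorem mem_zval (G τ x : ZFSet) :
    x ∈ zval G τ ↔ ∃ σ p, p ∈ G ∧ ZFSet.pair σ p ∈ τ ∧ x = zval G σ := by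
  have hrank : ∀ σ p, ZFSet.pair σ p ∈ τ → ZFSet.rank σ < ZFSet.rank τ := by
    intro σ p h
    have h1 : σ ∈ ({σ} : ZFSet) := by simp
    have h2 : ({σ} : ZFSet) ∈ ZFSet.pair σ p := by simp [ZFSet.pair]
    exact (ZFSet.rank_lt_of_mem h1).trans ((ZFSet.rank_lt_of_mem h2).trans (ZFSet.rank_lt_of_mem h))
  have hU : ∀ σ p, ZFSet.pair σ p ∈ τ → σ ∈ ZFSet.sUnion (ZFSet.sUnion τ) := by
    intro σ p h
    exact ZFSet.mem_sUnion.2 ⟨{σ}, ZFSet.mem_sUnion.2 ⟨_, h, by simp [ZFSet.pair]⟩, by simp⟩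
  unfold zval
  rw [WellFounded.fix_eq]
  letI : ∀ (n : ℕ) (f : (Fin n → ZFSet) → ZFSet), ZFSet.Definable n f := fun _ _ => Classical.allZFSetDefinable _
  refine (ZFSet.mem_image).trans ?_
  constructor
  · rintro ⟨σ, hσ, rfl⟩
    rw [ZFSet.mem_sep] at hσ
    obtain ⟨-, p, hp, h⟩ := hσ
    refine ⟨σ, p, hp, h, ?_⟩
    rw [dif_pos (hrank _ _ h)]
  · rintro ⟨σ, p, hp, h, rfl⟩
    refine ⟨σ, ZFSet.mem_sep.2 ⟨hU _ _ h, p, hp, h⟩, ?_⟩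
    rw [dif_pos (hrank _ _ h)]

theorem mem_genExt (G x : ZFSet) : x ∈ genExt M G ↔ ∃ τ : U M, zval G τ.1 = x := by
  unfold genExt
  letI : ∀ (n : ℕ) (f : (Fin n → ZFSet) → ZFSet), ZFSet.Definable n f := fun _ _ => Classical.allZFSetDefinable _
  refine (ZFSet.mem_image).trans ?_
  constructor
  · rintro ⟨z, hz, h⟩
    exact ⟨⟨z, hz⟩, h⟩
  · rintro ⟨z, h⟩
    exact ⟨z.1, z.2, h⟩

theorem le_P (hf : ForcingNotion M P.1 r.1 one) {a b : U M} (h : In a b r) :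
    a.1 ∈ P.1 ∧ b.1 ∈ P.1 := by
  obtain ⟨a', ha, b', hb, e⟩ := hf.2.2.2.1 _ h
  rw [ZFSet.pair_inj] at e
  rw [e.1, e.2]
  exact ⟨ha, hb⟩

theorem le_trans' (hf : ForcingNotion M P.1 r.1 one) {a b d : U M} (h : In a b r) (h' : In b d r) :
    In a d r :=
  hf.2.2.2.2.2.1 _ (le_P hf h).1 _ (le_P hf h).2 _ (le_P hf h').2 h h'

theorem le_rfl' (hf : ForcingNotion M P.1 r.1 one) {a : U M} (h : a.1 ∈ P.1) : In a a r :=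
  hf.2.2.2.2.1 _ h

theorem gen_P {G : ZFSet} (hG : IsGeneric M r.1 P.1 G) {a : ZFSet} (h : a ∈ G) : a ∈ P.1 :=
  hG.1.1 h

theorem gen_up (hf : ForcingNotion M P.1 r.1 one) {G : ZFSet} (hG : IsGeneric M r.1 P.1 G)
    {a b : U M} (h : a.1 ∈ G) (hab : In a b r) : b.1 ∈ G :=
  hG.1.2.1 _ h _ (le_P hf hab).2 hab

theorem gen_dir (ht : M.IsTransitive) {G : ZFSet} (hG : IsGeneric M r.1 P.1 G)
    {a b : U M} (ha : a.1 ∈ G) (hb : b.1 ∈ G) : ∃ d : U M, d.1 ∈ G ∧ In d a r ∧ In d b r := by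
  obtain ⟨z, hz, h1, h2⟩ := hG.1.2.2 _ ha _ hb
  exact ⟨⟨z, m_up ht P.2 (gen_P hG hz)⟩, hz, h1, h2⟩

/-- Existence of generic filters. -/
theorem exists_gen (hcount : M.toSet.Countable) (ht : M.IsTransitive)
    (hf : ForcingNotion M P.1 r.1 one) {p : U M} (hp : p.1 ∈ P.1) :
    ∃ G, IsGeneric M r.1 P.1 G ∧ p.1 ∈ G := by
  obtain ⟨D, hD⟩ := hcount.exists_eq_range ⟨P.1, P.2⟩
  have hstep : ∀ (m : ℕ) (q : {q : U M // q.1 ∈ P.1}), ∃ q' : {q : U M // q.1 ∈ P.1},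
      In q'.1 q.1 r ∧ (IsDenseIn r.1 P.1 (D m) → q'.1.1 ∈ D m) := by
    intro m q
    by_cases h : IsDenseIn r.1 P.1 (D m)
    · obtain ⟨d, hd, hdq⟩ := h.2 q.1.1 q.2
      exact ⟨⟨⟨d, m_up ht P.2 (h.1 hd)⟩, h.1 hd⟩, hdq, fun _ => hd⟩
    · exact ⟨q, le_rfl' hf q.2, fun h' => absurd h' h⟩
  choose f hf1 hf2 using hstep
  let s : ℕ → {q : U M // q.1 ∈ P.1} := fun m => Nat.rec ⟨p, hp⟩ (fun m q => f m q) m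
  have hs : ∀ m, s (m + 1) = f m (s m) := fun m => rfl
  have hmono : ∀ m l, In (s (m + l)).1 (s m).1 r := by
    intro m l
    induction l with
    | zero => exact le_rfl' hf (s m).2
    | succ l ih =>
      rw [← Nat.add_assoc, hs]
      exact le_trans' hf (hf1 _ _) ih
  refine ⟨ZFSet.sep (fun x => ∃ m, ZFSet.pair (s m).1.1 x ∈ r.1) P.1, ⟨⟨?_, ?_, ?_⟩, ?_⟩, ?_⟩
  · intro x hx
    exact (ZFSet.mem_sep.1 hx).1
  · intro x hx y hy hxy
    obtain ⟨hxP, m, hm⟩ := ZFSet.mem_sep.1 hx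
    exact ZFSet.mem_sep.2 ⟨hy, m, hf.2.2.2.2.2.1 _ (s m).2 _ hxP _ hy hm hxy⟩
  · intro x hx y hy
    obtain ⟨hxP, m, hm⟩ := ZFSet.mem_sep.1 hx
    obtain ⟨hyP, l, hl⟩ := ZFSet.mem_sep.1 hy
    refine ⟨(s (m + l)).1.1, ZFSet.mem_sep.2 ⟨(s (m + l)).2, m + l, le_rfl' hf (s (m + l)).2⟩, ?_, ?_⟩
    · exact hf.2.2.2.2.2.1 _ (s (m + l)).2 _ (s m).2 _ hxP (hmono m l) hm
    · refine hf.2.2.2.2.2.1 _ (s (m + l)).2 _ (s l).2 _ hyP ?_ hl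
      rw [Nat.add_comm]
      exact hmono l m
  · intro E hE hdense
    have : E ∈ Set.range D := by rw [← hD]; exact hE
    obtain ⟨m, rfl⟩ := this
    refine ⟨(s (m + 1)).1.1, ZFSet.mem_sep.2 ⟨(s (m + 1)).2, m + 1, le_rfl' hf (s (m + 1)).2⟩, ?_⟩
    exact hf2 m (s m) hdense
  · exact ZFSet.mem_sep.2 ⟨hp, 0, le_rfl' hf hp⟩

/-- A generic filter decides every definable property of conditions. -/
theorem gen_decide (ht : M.IsTransitive) (hm : ZModels M ZF) (hf : ForcingNotion M P.1 r.1 one)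
    (hr : ∃ i, c i = r) {Q : U M → Prop} (hQ : Dfn c (fun v : Fin 1 → U M => Q (v 0)))
    {G : ZFSet} (hG : IsGeneric M r.1 P.1 G) :
    ∃ q : U M, q.1 ∈ G ∧ (Q q ∨ ∀ s, In s q r → ¬ Q s) := by
  have hQ' : ∀ {n : ℕ} {f : (Fin n → U M) → U M}, IsTm c f → Dfn c (fun v => Q (f v)) :=
    fun {n} {f} h => hQ.subst (fun _ => f) (fun _ => h)
  have hd : Dfn c (fun v : Fin 1 → U M => Q (v 0) ∨ ∀ s, In s (v 0) r → ¬ Q s) := by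
    repeat' first
      | exact IsTm.var _
      | exact IsTm.cst hr
      | apply Dfn.subst3 (dfn_In ht hm)
      | apply hQ'
      | apply Dfn.or
      | apply Dfn.all
      | apply Dfn.not
      | apply Dfn.imp
  obtain ⟨D, hD⟩ := sep_of_dfn hm (R := fun x => Q x ∨ ∀ s, In s x r → ¬ Q s) hd P
  obtain ⟨q, hqG, hqD⟩ := hG.2 D.1 D.2 (by
    constructor
    · intro x hx
      exact ((hD ⟨x, m_up ht D.2 hx⟩).1 hx).1
    · intro p hp
      let p' : U M := ⟨p, m_up ht P.2 hp⟩
      by_cases h : ∃ s, In s p' r ∧ Q s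
      · obtain ⟨s, hs, hs'⟩ := h
        exact ⟨s.1, (hD s).2 ⟨(le_P hf hs).1, Or.inl hs'⟩, hs⟩
      · push Not at h
        exact ⟨p, (hD p').2 ⟨hp, Or.inr h⟩, le_rfl' hf (a := p') hp⟩)
  exact ⟨⟨q, m_up ht D.2 hqD⟩, hqG, ((hD ⟨q, m_up ht D.2 hqD⟩).1 hqD).2⟩

theorem gen_below (ht : M.IsTransitive) (hm : ZModels M ZF) (hf : ForcingNotion M P.1 r.1 one)
    (hr : ∃ i, c i = r) {Q : U M → Prop} (hQ : Dfn c (fun v : Fin 1 → U M => Q (v 0)))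
    {G : ZFSet} (hG : IsGeneric M r.1 P.1 G) {p : U M} (hp : p.1 ∈ G)
    (h : ∀ q, In q p r → ∃ s, In s q r ∧ Q s) : ∃ q : U M, q.1 ∈ G ∧ Q q := by
  obtain ⟨q, hq, h1 | h1⟩ := gen_decide ht hm hf hr hQ hG
  · exact ⟨q, hq, h1⟩
  · obtain ⟨d, hd, hdp, hdq⟩ := gen_dir ht hG hp hq
    obtain ⟨s, hs, hs'⟩ := h d hdp
    exact absurd hs' (h1 s (le_trans' hf hs hdq))

end Generic

section AtomicTruth

variable {M : ZFSet} {P r : U M} {one : ZFSet}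

theorem Est.symm (ht : M.IsTransitive) (hm : ZModels M ZF) (hf : ForcingNotion M P.1 r.1 one)
    {p σ τ : U M} (h : Est r p σ τ) : Est r p τ σ :=
  Est.of_phi ht hm (fun _ _ h => (le_P hf h).1) ⟨h.phi.2, h.phi.1⟩

theorem Est.down (ht : M.IsTransitive) (hm : ZModels M ZF) (hf : ForcingNotion M P.1 r.1 one)
    {p q σ τ : U M} (h : Est r p σ τ) (hq : In q p r) : Est r q σ τ :=
  Est.of_phi ht hm (fun _ _ h => (le_P hf h).1)
    ⟨fun σ' s hs q' hq' => h.phi.1 σ' s hs q' (le_trans' hf hq' hq),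
      fun σ' s hs q' hq' => h.phi.2 σ' s hs q' (le_trans' hf hq' hq)⟩

theorem half_sound (ht : M.IsTransitive) (hm : ZModels M ZF) (hf : ForcingNotion M P.1 r.1 one)
    {G : ZFSet} (hG : IsGeneric M r.1 P.1 G) {p σ τ : U M} (hp : p.1 ∈ G)
    (h : Half r (Est r) p σ τ)
    (ih : ∀ (q σ' τ' s t : U M), In σ' s σ → In τ' t τ → q.1 ∈ G → Est r q σ' τ' →
      zval G σ'.1 = zval G τ'.1) : zval G σ.1 ⊆ zval G τ.1 := by
  intro x hx
  obtain ⟨σ', s, hs, hσ', rfl⟩ := (mem_zval _ _ _).1 hx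
  have hM := m_up_pair ht σ.2 hσ'
  let σ'' : U M := ⟨σ', hM.1⟩
  let s' : U M := ⟨s, hM.2⟩
  let c : Fin 4 → U M := ![r, σ'', s', τ]
  have hr : ∃ i, c i = r := ⟨0, rfl⟩
  have h1 : ∃ i, c i = σ'' := ⟨1, rfl⟩
  have h2 : ∃ i, c i = s' := ⟨2, rfl⟩
  have h3 : ∃ i, c i = τ := ⟨3, rfl⟩
  obtain ⟨p', hp', hpp, hps⟩ := gen_dir ht hG (b := s') hp hs
  obtain ⟨q, hq, τ', t, hτ', hqt, hE⟩ := gen_below ht hm hf hr (Q := fun q' => ∃ τ' t : U M, In τ' t τ ∧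
      In q' t r ∧ Est r q' σ'' τ') (by
    repeat' first
      | exact IsTm.var _
      | exact IsTm.cst hr
      | exact IsTm.cst h1
      | exact IsTm.cst h2
      | exact IsTm.cst h3
      | apply Dfn.subst3 (dfn_In ht hm)
      | apply Dfn.subst3 (dfn_Est ht hm hr)
      | apply Dfn.and
      | apply Dfn.ex
      | apply Dfn.imp) hG hp' (by
    intro q hq
    obtain ⟨q', hq', h'⟩ := h σ'' s' hσ' q (le_trans' hf hq hpp)
    exact ⟨q', hq', h' (le_trans' hf hq' (le_trans' hf hq hps))⟩)
  exact (mem_zval _ _ _).2 ⟨τ'.1, t.1, gen_up hf hG hq hqt, hτ', ih q σ'' τ' s' t hσ' hτ' hq hE⟩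

theorem In.rank {a b x : U M} (h : In a b x) : ZFSet.rank a.1 < ZFSet.rank x.1 := by
  have h1 : a.1 ∈ ({a.1} : ZFSet) := by simp
  have h2 : ({a.1} : ZFSet) ∈ ZFSet.pair a.1 b.1 := by simp [ZFSet.pair]
  exact (ZFSet.rank_lt_of_mem h1).trans ((ZFSet.rank_lt_of_mem h2).trans (ZFSet.rank_lt_of_mem h))

theorem name_ind {C : U M → Prop} (h : ∀ σ, (∀ σ' s, In σ' s σ → C σ') → C σ) (σ : U M) : C σ := by
  have hw : WellFounded (fun a b : U M => ZFSet.rank a.1 < ZFSet.rank b.1) :=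
    InvImage.wf (fun a : U M => ZFSet.rank a.1) Ordinal.lt_wf
  exact hw.induction σ fun σ ih => h σ fun σ' s hs => ih σ' hs.rank

theorem est_sound (ht : M.IsTransitive) (hm : ZModels M ZF) (hf : ForcingNotion M P.1 r.1 one)
    {G : ZFSet} (hG : IsGeneric M r.1 P.1 G) (σ : U M) : ∀ (p τ : U M), p.1 ∈ G → Est r p σ τ →
      zval G σ.1 = zval G τ.1 := by
  induction σ using name_ind with | h σ ih => ?_
  intro p τ hp h
  apply ZFSet.ext
  intro x
  constructor
  · intro hx
    exact half_sound ht hm hf hG hp h.phi.1 (fun q σ' τ' s t hs _ hq hE => ih σ' s hs q τ' hq hE) hx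
  · intro hx
    exact half_sound ht hm hf hG hp h.phi.2
      (fun q σ' τ' s t _ hs hq hE => (ih τ' t hs q σ' hq (hE.symm ht hm hf)).symm) hx

/-- `q` forces that some element of `σ` is not in `τ`. -/
def Wit (r q σ τ : U M) : Prop :=
  ∃ σ' s : U M, In σ' s σ ∧ In q s r ∧ ∀ q' : U M, In q' q r →
    ¬ ∃ τ' t : U M, In τ' t τ ∧ In q' t r ∧ Est r q' σ' τ'

theorem dfn_Wit {k : ℕ} {c : Fin k → U M} (ht : M.IsTransitive) (hm : ZModels M ZF)
    (hr : ∃ i, c i = r) : Dfn c (fun v : Fin 3 → U M => Wit r (v 0) (v 1) (v 2)) := by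
  unfold Wit
  repeat' first
      | exact IsTm.var _
      | exact IsTm.cst hr
      | apply Dfn.subst3 (dfn_In ht hm)
      | apply Dfn.subst3 (dfn_Est ht hm hr)
      | apply Dfn.and
      | apply Dfn.ex
      | apply Dfn.not
      | apply Dfn.all
      | apply Dfn.imp

theorem wit_of_not_half (hf : ForcingNotion M P.1 r.1 one) {p σ τ : U M}
    (h : ¬ Half r (Est r) p σ τ) : ∃ q, In q p r ∧ Wit r q σ τ := by
  unfold Half at h
  push Not at h
  obtain ⟨σ', s, hs, q, hq, h⟩ := h
  refine ⟨q, hq, σ', s, hs, (h q (le_rfl' hf (le_P hf hq).1)).1, ?_⟩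
  rintro q' hq' ⟨τ', t, h1, h2, h3⟩
  exact (h q' hq').2 τ' t h1 h2 h3

theorem wit_absurd (ht : M.IsTransitive) (hm : ZModels M ZF) (hf : ForcingNotion M P.1 r.1 one)
    {G : ZFSet} (hG : IsGeneric M r.1 P.1 G) {q σ τ : U M} (hq : q.1 ∈ G) (h : Wit r q σ τ)
    (he : zval G σ.1 ⊆ zval G τ.1)
    (ih : ∀ σ' τ' s t : U M, In σ' s σ → In τ' t τ → zval G σ'.1 = zval G τ'.1 →
      ∃ p : U M, p.1 ∈ G ∧ Est r p σ' τ') : False := by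
  obtain ⟨σ', s, hs, hqs, h⟩ := h
  have h1 : zval G σ'.1 ∈ zval G σ.1 :=
    (mem_zval _ _ _).2 ⟨σ'.1, s.1, gen_up hf hG hq hqs, hs, rfl⟩
  obtain ⟨τ', t, htG, hτ', e⟩ := (mem_zval _ _ _).1 (he h1)
  have hM := m_up_pair ht τ.2 hτ'
  obtain ⟨p, hp, hE⟩ := ih σ' ⟨τ', hM.1⟩ s ⟨t, hM.2⟩ hs hτ' e
  obtain ⟨d, hd, hdp, hdq⟩ := gen_dir ht hG hp hq
  obtain ⟨u, hu, hud, hut⟩ := gen_dir ht hG (b := (⟨t, hM.2⟩ : U M)) hd htG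
  exact h u (le_trans' hf hud hdq) ⟨⟨τ', hM.1⟩, ⟨t, hM.2⟩, hτ', hut,
    hE.down ht hm hf (le_trans' hf hud hdp)⟩

theorem est_complete (ht : M.IsTransitive) (hm : ZModels M ZF) (hf : ForcingNotion M P.1 r.1 one)
    {G : ZFSet} (hG : IsGeneric M r.1 P.1 G) (σ : U M) : ∀ (τ : U M), zval G σ.1 = zval G τ.1 →
      ∃ p : U M, p.1 ∈ G ∧ Est r p σ τ := by
  induction σ using name_ind with | h σ ih => ?_
  intro τ he
  let c : Fin 3 → U M := ![r, σ, τ]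
  have hr : ∃ i, c i = r := ⟨0, rfl⟩
  have h1 : ∃ i, c i = σ := ⟨1, rfl⟩
  have h2 : ∃ i, c i = τ := ⟨2, rfl⟩
  obtain ⟨q, hq, h⟩ := gen_decide ht hm hf hr
    (Q := fun q => Est r q σ τ ∨ Wit r q σ τ ∨ Wit r q τ σ) (by
    repeat' first
      | exact IsTm.var _
      | exact IsTm.cst hr
      | exact IsTm.cst h1
      | exact IsTm.cst h2
      | apply Dfn.subst3 (dfn_Est ht hm hr)
      | apply Dfn.subst3 (dfn_Wit ht hm hr)
      | apply Dfn.or) hG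
  have hlast : ∀ s, In s q r → Est r s σ τ ∨ ∃ u, In u s r ∧ (Wit r u σ τ ∨ Wit r u τ σ) := by
    intro s hs
    by_cases hh : Phi r (Est r) s σ τ
    · exact Or.inl (Est.of_phi ht hm (fun _ _ h => (le_P hf h).1) hh)
    · right
      rcases not_and_or.1 hh with hh | hh
      · obtain ⟨u, hu, h⟩ := wit_of_not_half hf hh
        exact ⟨u, hu, Or.inl h⟩
      · obtain ⟨u, hu, h⟩ := wit_of_not_half hf hh
        exact ⟨u, hu, Or.inr h⟩
  have hqq := le_rfl' (M := M) hf (gen_P hG hq)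
  rcases h with (h | h | h) | h
  · exact ⟨q, hq, h⟩
  · exact (wit_absurd ht hm hf hG hq h (he ▸ fun _ h => h)
      (fun σ' τ' s t hs _ e => ih σ' s hs τ' e)).elim
  · refine (wit_absurd ht hm hf hG hq h (he ▸ fun _ h => h) ?_).elim
    intro σ' τ' s t _ hs e
    obtain ⟨p, hp, h⟩ := ih τ' t hs σ' e.symm
    exact ⟨p, hp, h.symm ht hm hf⟩
  · rcases hlast q hqq with h' | ⟨u, hu, h'⟩
    · exact (h q hqq (Or.inl h')).elim
    · exact (h u hu (Or.inr h')).elim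

end AtomicTruth
section Semantic

attribute [local instance] zfStruct

variable {M : ZFSet} {P r : U M} {one : ZFSet} {k n : ℕ} {c : Fin k → U M}

/-- Make some variables into constants. -/
theorem Dfn.fix {F : U M → (Fin n → U M) → Prop}
    (hF : Dfn c (fun v : Fin (n + 1) → U M => F (v 0) (fun i => v i.succ))) (τ : Fin n → U M)
    {m : ℕ} {f : (Fin m → U M) → U M} (hf : IsTm (Fin.append c τ) f) :
    Dfn (Fin.append c τ) (fun v : Fin m → U M => F (f v) τ) := by
  obtain ⟨φ, hφ⟩ := hF
  obtain ⟨t, ht⟩ := hf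
  refine ⟨subV (Sum.elim (fun a => Sum.inl (Fin.castAdd n a))
    (Fin.cons t (fun i => Sum.inl (Fin.natAdd k i)))) φ, fun v => ?_⟩
  rw [rz_subV]
  have h1 : (fun a : Fin k => Sum.elim (Fin.append c τ) v (Sum.elim (fun a => Sum.inl (Fin.castAdd n a))
    (Fin.cons t (fun i => Sum.inl (Fin.natAdd k i)) : Fin (n + 1) → Fin (k + n) ⊕ Fin m) (Sum.inl a))) = c := by
    funext a; simp
  rw [h1, hφ]
  beta_reduce
  rw [ht]
  simp

/-- `p` forces `S τ`. -/
def Forc (P r : U M) (S : ZFSet → (Fin n → U M) → Prop) (p : U M) (τ : Fin n → U M) : Prop :=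
  ∀ G, IsGeneric M r.1 P.1 G → p.1 ∈ G → S G τ

/-- Definability and truth lemma for `S`. -/
def Good (c : Fin k → U M) (P r : U M) (S : ZFSet → (Fin n → U M) → Prop) : Prop :=
  Dfn c (fun v : Fin (n + 1) → U M => Forc P r S (v 0) (fun i => v i.succ)) ∧
    ∀ G, IsGeneric M r.1 P.1 G → ∀ τ, S G τ → ∃ p : U M, p.1 ∈ G ∧ Forc P r S p τ

theorem cst_append (hr : ∃ i, c i = r) (τ : Fin n → U M) : ∃ i, Fin.append c τ i = r := by
  obtain ⟨i, hi⟩ := hr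
  exact ⟨Fin.castAdd n i, by simpa using hi⟩

theorem Good.of (hcount : M.toSet.Countable) (ht : M.IsTransitive) (hm : ZModels M ZF)
    (hf : ForcingNotion M P.1 r.1 one) (hr : ∃ i, c i = r)
    {S : ZFSet → (Fin n → U M) → Prop} (F : U M → (Fin n → U M) → Prop)
    (hF : Dfn c (fun v : Fin (n + 1) → U M => F (v 0) (fun i => v i.succ)))
    (hs : ∀ G, IsGeneric M r.1 P.1 G → ∀ τ (u : U M), u.1 ∈ G → F u τ → S G τ)
    (hc : ∀ G, IsGeneric M r.1 P.1 G → ∀ τ, S G τ → ∃ u : U M, u.1 ∈ G ∧ F u τ) :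
    Good c P r S := by
  have key : ∀ p τ, Forc P r S p τ ↔ ∀ q, In q p r → ∃ s, In s q r ∧ ∃ u, In s u r ∧ F u τ := by
    intro p τ
    constructor
    · intro h q hq
      obtain ⟨G, hG, hqG⟩ := exists_gen hcount ht hf (le_P hf hq).1
      obtain ⟨u, hu, hFu⟩ := hc G hG τ (h G hG (gen_up hf hG hqG hq))
      obtain ⟨s, -, hsq, hsu⟩ := gen_dir ht hG hqG hu
      exact ⟨s, hsq, u, hsu, hFu⟩
    · intro h G hG hp
      have hr' := cst_append hr τ
      obtain ⟨s, hsG, u, hsu, hFu⟩ := gen_below ht hm hf hr' (Q := fun s => ∃ u, In s u r ∧ F u τ) (by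
        repeat' first
          | exact IsTm.var _
          | exact IsTm.cst hr'
          | apply Dfn.subst3 (dfn_In ht hm)
          | apply Dfn.fix hF
          | apply Dfn.and
          | apply Dfn.ex) hG hp h
      exact hs G hG τ u (gen_up hf hG hsG hsu) hFu
  constructor
  · refine Dfn.congr ?_ (fun v => key _ _)
    have hF' : ∀ {m : ℕ} {f : (Fin m → U M) → U M} {g : Fin n → (Fin m → U M) → U M}, IsTm c f →
        (∀ i, IsTm c (g i)) → Dfn c (fun v => F (f v) (fun i => g i v)) := by
      intro m f g hf hg
      exact (hF.subst (Fin.cons f g) (Fin.cases hf hg)).congr (fun v => by simp)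
    repeat' first
      | exact IsTm.var _
      | exact IsTm.cst hr
      | exact fun i => IsTm.var _
      | apply Dfn.subst3 (dfn_In ht hm)
      | apply hF'
      | apply Dfn.and
      | apply Dfn.ex
      | apply Dfn.all
      | apply Dfn.imp
  · intro G hG τ h
    obtain ⟨u, hu, hFu⟩ := hc G hG τ h
    exact ⟨u, hu, fun G' hG' hu' => hs G' hG' τ u hu' hFu⟩

theorem Forc.down (hf : ForcingNotion M P.1 r.1 one) {S : ZFSet → (Fin n → U M) → Prop}
    {p q : U M} {τ : Fin n → U M} (h : Forc P r S p τ) (hq : In q p r) : Forc P r S q τ :=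
  fun G hG hqG => h G hG (gen_up hf hG hqG hq)

theorem Good.fls (hcount : M.toSet.Countable) (ht : M.IsTransitive) (hm : ZModels M ZF)
    (hf : ForcingNotion M P.1 r.1 one) (hr : ∃ i, c i = r) :
    Good c P r (fun _ (_ : Fin n → U M) => False) :=
  Good.of hcount ht hm hf hr (fun _ _ => False) Dfn.fls (fun _ _ _ _ _ h => h) (fun _ _ _ h => h.elim)

theorem Good.eq (hcount : M.toSet.Countable) (ht : M.IsTransitive) (hm : ZModels M ZF)
    (hf : ForcingNotion M P.1 r.1 one) (hr : ∃ i, c i = r) (i j : Fin n) :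
    Good c P r (fun G (τ : Fin n → U M) => zval G (τ i).1 = zval G (τ j).1) := by
  refine Good.of hcount ht hm hf hr (fun p τ => Est r p (τ i) (τ j)) ?_ ?_ ?_
  · exact Dfn.subst3 (dfn_Est ht hm hr) (IsTm.var _) (IsTm.var _) (IsTm.var _)
  · intro G hG τ u hu h
    exact est_sound ht hm hf hG _ _ _ hu h
  · intro G hG τ h
    exact est_complete ht hm hf hG _ _ h

theorem Good.mem (hcount : M.toSet.Countable) (ht : M.IsTransitive) (hm : ZModels M ZF)
    (hf : ForcingNotion M P.1 r.1 one) (hr : ∃ i, c i = r) (i j : Fin n) :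
    Good c P r (fun G (τ : Fin n → U M) => zval G (τ i).1 ∈ zval G (τ j).1) := by
  refine Good.of hcount ht hm hf hr
    (fun p τ => ∃ τ' t : U M, In τ' t (τ j) ∧ In p t r ∧ Est r p (τ i) τ') ?_ ?_ ?_
  · repeat' first
      | exact IsTm.var _
      | exact IsTm.cst hr
      | apply Dfn.subst3 (dfn_In ht hm)
      | apply Dfn.subst3 (dfn_Est ht hm hr)
      | apply Dfn.and
      | apply Dfn.ex
  · rintro G hG τ u hu ⟨τ', t, h1, h2, h3⟩
    exact (mem_zval _ _ _).2 ⟨τ'.1, t.1, gen_up hf hG hu h2, h1, est_sound ht hm hf hG _ _ _ hu h3⟩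
  · intro G hG τ h
    obtain ⟨τ', t, htG, hτ', e⟩ := (mem_zval _ _ _).1 h
    have hM := m_up_pair ht (τ j).2 hτ'
    obtain ⟨p, hp, hE⟩ := est_complete ht hm hf hG (τ i) ⟨τ', hM.1⟩ e
    obtain ⟨d, hd, hdp, hdt⟩ := gen_dir ht hG (b := (⟨t, hM.2⟩ : U M)) hp htG
    exact ⟨d, hd, ⟨τ', hM.1⟩, ⟨t, hM.2⟩, hτ', hdt, hE.down ht hm hf hdp⟩

theorem Good.imp (hcount : M.toSet.Countable) (ht : M.IsTransitive) (hm : ZModels M ZF)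
    (hf : ForcingNotion M P.1 r.1 one) (hr : ∃ i, c i = r)
    {S T : ZFSet → (Fin n → U M) → Prop} (hS : Good c P r S) (hT : Good c P r T) :
    Good c P r (fun G τ => S G τ → T G τ) := by
  refine Good.of hcount ht hm hf hr
    (fun p τ => ∀ q, In q p r → Forc P r S q τ → Forc P r T q τ) ?_ ?_ ?_
  · have hF' : ∀ {S : ZFSet → (Fin n → U M) → Prop}, Good c P r S →
        ∀ {m : ℕ} {f : (Fin m → U M) → U M} {g : Fin n → (Fin m → U M) → U M}, IsTm c f →
        (∀ i, IsTm c (g i)) → Dfn c (fun v => Forc P r S (f v) (fun i => g i v)) := by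
      intro S hS m f g hf hg
      exact (hS.1.subst (Fin.cons f g) (Fin.cases hf hg)).congr (fun v => by simp)
    repeat' first
      | exact IsTm.var _
      | exact IsTm.cst hr
      | exact fun i => IsTm.var _
      | apply Dfn.subst3 (dfn_In ht hm)
      | apply hF' hS
      | apply hF' hT
      | apply Dfn.all
      | apply Dfn.imp
  · intro G hG τ u hu h hSG
    obtain ⟨p, hp, hpS⟩ := hS.2 G hG τ hSG
    obtain ⟨d, hd, hdp, hdu⟩ := gen_dir ht hG hp hu
    exact h d hdu (hpS.down hf hdp) G hG hd
  · intro G hG τ h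
    by_cases hh : S G τ
    · obtain ⟨p, hp, hpT⟩ := hT.2 G hG τ (h hh)
      exact ⟨p, hp, fun q hq _ => hpT.down hf hq⟩
    · obtain ⟨q, hq, h' | h'⟩ := gen_decide ht hm hf (cst_append hr τ)
        (Q := fun q => Forc P r S q τ) (Dfn.fix hS.1 τ (IsTm.var 0)) hG
      · exact (hh (h' G hG hq)).elim
      · exact ⟨q, hq, fun s hs hs' => (h' s hs hs').elim⟩

theorem Good.all (hcount : M.toSet.Countable) (ht : M.IsTransitive) (hm : ZModels M ZF)
    (hf : ForcingNotion M P.1 r.1 one) (hr : ∃ i, c i = r)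
    {S : ZFSet → (Fin (n + 1) → U M) → Prop} (hS : Good c P r S) :
    Good c P r (fun G (τ : Fin n → U M) => ∀ x : U M, S G (Fin.snoc τ x)) := by
  have hS' : Dfn c (fun v : Fin (n + 2) → U M =>
      Forc P r S (v 0) (Fin.snoc (fun i : Fin n => v i.succ.castSucc) (v (Fin.last _)))) := by
    refine hS.1.congr fun v => ?_
    have : (Fin.snoc (fun i : Fin n => v i.succ.castSucc) (v (Fin.last _)) : Fin (n + 1) → U M) =
        fun i => v i.succ := by
      funext i
      refine Fin.lastCases ?_ (fun i => ?_) i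
      · simp
      · simp
    rw [this]
  refine Good.of hcount ht hm hf hr (fun p τ => ∀ x : U M, Forc P r S p (Fin.snoc τ x)) ?_ ?_ ?_
  · exact Dfn.all (R := fun (v : Fin (n + 1) → U M) x => Forc P r S (v 0)
      (Fin.snoc (fun i : Fin n => v i.succ) x)) hS'
  · intro G hG τ u hu h x
    exact h x G hG hu
  · intro G hG τ h
    have hr' := cst_append hr τ
    have hQ : Dfn (Fin.append c τ) (fun v : Fin 1 → U M => ∃ x : U M, ∀ s, In s (v 0) r →
        ¬ Forc P r S s (Fin.snoc τ x)) := by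
      have hd : Dfn c (fun v : Fin (n + 1) → U M => ∃ x : U M, ∀ s, In s (v 0) r →
        ¬ Forc P r S s (Fin.snoc (fun i : Fin n => v i.succ) x)) := by
        refine Dfn.ex (R := fun (v : Fin (n + 1) → U M) x => ∀ s, In s (v 0) r →
          ¬ Forc P r S s (Fin.snoc (fun i : Fin n => v i.succ) x)) ?_
        refine Dfn.all (R := fun (v : Fin (n + 2) → U M) s => In s (v 0) r →
          ¬ Forc P r S s (Fin.snoc (fun i : Fin n => v i.succ.castSucc) (v (Fin.last _)))) ?_
        refine Dfn.imp ?_ (Dfn.not ?_)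
        · exact Dfn.subst3 (dfn_In ht hm) (IsTm.var _) (IsTm.var _) (IsTm.cst hr)
        · refine (hS'.subst (n := n + 3) (Fin.cons (fun v => v (Fin.last _))
            (fun i => fun v => v i.succ.castSucc)) (Fin.cases (IsTm.var _) (fun i => IsTm.var _))).congr ?_
          intro v
          rfl
      exact Dfn.fix (F := fun p τ => ∃ x : U M, ∀ s, In s p r →
        ¬ Forc P r S s (Fin.snoc τ x)) hd τ (IsTm.var 0)
    obtain ⟨q, hq, ⟨x, hx⟩ | h'⟩ := gen_decide ht hm hf hr'
      (Q := fun p => ∃ x : U M, ∀ s, In s p r → ¬ Forc P r S s (Fin.snoc τ x)) hQ hG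
    · obtain ⟨p, hp, hpS⟩ := hS.2 G hG _ (h x)
      obtain ⟨d, hd, hdp, hdq⟩ := gen_dir ht hG hp hq
      exact (hx d hdq (hpS.down hf hdp)).elim
    · refine ⟨q, hq, fun x G' hG' hq' => ?_⟩
      obtain ⟨u, hu, hu'⟩ := gen_below ht hm hf (cst_append hr (Fin.snoc τ x : Fin (n + 1) → U M))
        (Q := fun q => Forc P r S q (Fin.snoc τ x)) (Dfn.fix hS.1 _ (IsTm.var 0)) hG' hq' (by
        intro s hs
        have := h' s hs
        push Not at this
        exact this x)
      exact hu' G' hG' hu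

/-- Truth of `φ` in the generic extension. -/
def Sat (φ : BF n) (G : ZFSet) (τ : Fin n → U M) : Prop :=
  BoundedFormula.Realize (M := U (genExt M G)) φ (fun e => e.elim)
    (fun i => ⟨zval G (τ i).1, (mem_genExt _ _).2 ⟨τ i, rfl⟩⟩)

theorem Good.congr {S T : ZFSet → (Fin n → U M) → Prop} (h : Good c P r T)
    (e : ∀ G τ, S G τ ↔ T G τ) : Good c P r S := by
  have : S = T := by funext G τ; exact propext (e G τ)
  rw [this]; exact h

theorem tm_var (t : SetLang.Term (Empty ⊕ Fin n)) : ∃ i, t = Term.var (Sum.inr i) := by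
  cases t with
  | var x =>
    rcases x with x | i
    · exact x.elim
    · exact ⟨i, rfl⟩
  | func f _ => exact Empty.elim f

theorem good_sat (hcount : M.toSet.Countable) (ht : M.IsTransitive) (hm : ZModels M ZF)
    (hf : ForcingNotion M P.1 r.1 one) (hr : ∃ i, c i = r) (φ : BF n) :
    Good c P r (Sat φ) := by
  induction φ with
  | falsum => exact Good.fls hcount ht hm hf hr
  | equal t₁ t₂ =>
    obtain ⟨i, rfl⟩ := tm_var t₁
    obtain ⟨j, rfl⟩ := tm_var t₂
    refine (Good.eq hcount ht hm hf hr i j).congr fun G τ => ?_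
    exact Subtype.ext_iff
  | rel R ts =>
    cases R
    obtain ⟨i, hi⟩ := tm_var (ts 0)
    obtain ⟨j, hj⟩ := tm_var (ts 1)
    refine (Good.mem hcount ht hm hf hr i j).congr fun G τ => ?_
    unfold Sat
    change (Term.realize (M := U (genExt M G)) _ (ts 0)).1 ∈ (Term.realize (M := U (genExt M G)) _ (ts 1)).1 ↔ _
    rw [hi, hj]
    rfl
  | imp φ ψ h1 h2 =>
    exact (Good.imp hcount ht hm hf hr h1 h2).congr fun G τ => Iff.rfl
  | all φ h =>
    refine (Good.all hcount ht hm hf hr h).congr fun G τ => ?_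
    have key : ∀ x : U M, (fun i => ⟨zval G ((Fin.snoc τ x : Fin (_ + 1) → U M) i).1,
        (mem_genExt _ _).2 ⟨(Fin.snoc τ x : Fin (_ + 1) → U M) i, rfl⟩⟩ : Fin (_ + 1) → U (genExt M G)) =
        Fin.snoc (fun i => ⟨zval G (τ i).1, (mem_genExt _ _).2 ⟨τ i, rfl⟩⟩)
          ⟨zval G x.1, (mem_genExt _ _).2 ⟨x, rfl⟩⟩ := by
      intro x
      funext i
      refine Fin.lastCases ?_ (fun i => ?_) i
      · simp
      · simp
    unfold Sat
    rw [BoundedFormula.realize_all]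
    constructor
    · intro h x
      rw [key]
      exact h _
    · rintro h ⟨a, ha⟩
      obtain ⟨x, rfl⟩ := (mem_genExt _ _).1 ha
      have := h x
      rw [key] at this
      exact this

end Semantic
/-- Definability of forcing: there is a map `φ ↦ forces(φ)` increasing arity
by at most 4 such that `(M,∈) ⊨ forces(φ)[p,P,≼,𝟙,τ₁,…,τₙ]` iff every generic `G ∋ p` makes
`φ` true in `M[G]` of the values of the names. -/
theorem forcing_definability (M : ZFSet) (hcount : M.toSet.Countable)
    (htrans : M.IsTransitive) (hmodel : ZModels M ZF)
    (P r one : ZFSet) (hforcing : ForcingNotion M P r one) :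
    ∃ forces : ∀ n : ℕ, BF n → BF (n + 4),
      ∀ (n : ℕ) (φ : BF n) (p : ZFSet), p ∈ P → ∀ τ : Fin n → ZFSet, (∀ i, τ i ∈ M) →
        (ZRealize M (forces n φ)
            (Fin.cons p (Fin.cons P (Fin.cons r (Fin.cons one τ)))) ↔
          ∀ G : ZFSet, IsGeneric M r P G → p ∈ G →
            ZRealize (genExt M G) φ (fun i => zval G (τ i))) := by
  have key : ∀ (n : ℕ) (φ : BF n), ∃ ψ : BF (n + 4), ∀ (p : ZFSet), p ∈ P →
      ∀ τ : Fin n → ZFSet, (∀ i, τ i ∈ M) →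
        (ZRealize M ψ (Fin.cons p (Fin.cons P (Fin.cons r (Fin.cons one τ)))) ↔
          ∀ G : ZFSet, IsGeneric M r P G → p ∈ G →
            ZRealize (genExt M G) φ (fun i => zval G (τ i))) := by
    intro n φ
    have hP := hforcing.1
    have hr := hforcing.2.1
    have hone := m_up htrans hP hforcing.2.2.1
    let P' : U M := ⟨P, hP⟩
    let r' : U M := ⟨r, hr⟩
    obtain ⟨ψ, hψ⟩ := (good_sat (P := P') (r := r') (c := ![P', r']) hcount htrans hmodel hforcing
      ⟨1, rfl⟩ φ).1.toBF
    refine ⟨reindex (Fin.append ![(1 : Fin (n + 4)), (2 : Fin (n + 4))]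
      (Fin.cons 0 (fun i : Fin n => i.succ.succ.succ.succ))) ψ, ?_⟩
    intro p hp τ hτ
    let τ' : Fin n → U M := fun i => ⟨τ i, hτ i⟩
    have hpM := m_up htrans hP hp
    have hall : ∀ i, (Fin.cons p (Fin.cons P (Fin.cons r (Fin.cons one τ))) : Fin (n + 4) → ZFSet) i ∈ M := by
      refine Fin.cases hpM (Fin.cases hP (Fin.cases hr (Fin.cases hone hτ)))
    have h1 : ZRealize M (reindex (Fin.append ![(1 : Fin (n + 4)), (2 : Fin (n + 4))]
      (Fin.cons 0 (fun i : Fin n => i.succ.succ.succ.succ))) ψ)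
        (Fin.cons p (Fin.cons P (Fin.cons r (Fin.cons one τ)))) ↔ Forc P' r' (Sat φ) ⟨p, hpM⟩ τ' := by
      unfold ZRealize
      rw [forall_prop_of_true hall]
      refine (rz_reindex _ _ _ _).trans ?_
      refine Iff.trans (iff_of_eq ?_) (hψ (fun e => e.elim) (Fin.cons ⟨p, hpM⟩ τ'))
      congr 1
      funext i
      refine Fin.addCases (fun i => ?_) (fun i => ?_) i
      · rw [Fin.append_left]
        apply Subtype.ext
        simp only [Fin.append_left]
        fin_cases i <;> rfl
      · rw [Fin.append_right]
        apply Subtype.ext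
        simp only [Fin.append_right]
        refine Fin.cases ?_ (fun i => ?_) i
        · rfl
        · rfl
    rw [h1]
    refine forall_congr' fun G => forall_congr' fun hG => forall_congr' fun hpG => ?_
    unfold ZRealize Sat
    constructor
    · intro h _
      exact h
    · intro h
      exact h _
  choose f hf using key
  exact ⟨f, hf⟩

end CtmForcing
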